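/- arXiv:2304.11659 — 11 statements merged into one kernel-verified Lean document; each statement's English description precedes it below -/
import Mathlib

section
/- Let n ≥ 2 be an integer and α ≥ 1 a real number, and let v : Fin n → Fin n → ℝ be the value matrix of an allocation (so v i j ≥ 0 for all i, j and Σ_j v i j = 1 for every i). If the allocation is α-EF, i.e., α · v i i ≥ v i j for all i, j, then it is (α − (α−1)/n)-proportional, i.e., v i i ≥ 1/(α·n − α + 1) for every i. -/
/-- If an allocation (given by its value matrix) is `α`-EF, then it is
`(α − (α−1)/n)`-proportional, i.e. `v i i ≥ 1/(α·n − α + 1)` for every agent `i`. -/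
theorem alphaEF_implies_proportional (n : ℕ) (hn : 2 ≤ n) (α : ℝ) (hα : 1 ≤ α)
    (v : Fin n → Fin n → ℝ)
    (hnonneg : ∀ i j, 0 ≤ v i j)
    (hsum : ∀ i, ∑ j, v i j = 1)
    (hEF : ∀ i j, v i j ≤ α * v i i) :
    ∀ i, 1 / (α * n - α + 1) ≤ v i i := by
  intro i
  have hn' : (2 : ℝ) ≤ n := by exact_mod_cast hn
  have hpos : 0 < α * n - α + 1 := by nlinarith
  have hcard : ((Finset.univ.erase i).card : ℝ) = n - 1 := by
    rw [Finset.card_erase_of_mem (Finset.mem_univ i), Finset.card_univ, Fintype.card_fin,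
      Nat.cast_pred (by lia)]
  have hothers : ∑ j ∈ Finset.univ.erase i, v i j ≤ (n - 1) * (α * v i i) := by
    have h := Finset.sum_le_card_nsmul (Finset.univ.erase i) (v i) _ fun j _ => hEF i j
    rwa [nsmul_eq_mul, hcard] at h
  have htotal := Finset.add_sum_erase Finset.univ (v i) (Finset.mem_univ i)
  rw [hsum i] at htotal
  rw [div_le_iff₀ hpos]
  linarith
end

section
/- Let n ≥ 2 be an integer and α ≥ 1 a real number, and let v : Fin n → Fin n → ℝ be the value matrix of an allocation (so v i j ≥ 0 for all i, j and Σ_j v i j = 1 for every i). If the allocation is α-EF, i.e., α · v i i ≥ v i j for all i, j, then it is ((α−1)/(α+1))-additive-EF, i.e., v i j − v i i ≤ (α−1)/(α+1) for all i, j. -/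
/-- If an allocation (given by its value matrix) is `α`-EF, then it is
`((α−1)/(α+1))`-additive-EF, i.e. `v i j − v i i ≤ (α−1)/(α+1)` for all `i, j`. -/
theorem alphaEF_implies_additiveEF (n : ℕ) (hn : 2 ≤ n) (α : ℝ) (hα : 1 ≤ α)
    (v : Fin n → Fin n → ℝ)
    (hnonneg : ∀ i j, 0 ≤ v i j)
    (hsum : ∀ i, ∑ j, v i j = 1)
    (hEF : ∀ i j, v i j ≤ α * v i i) :
    ∀ i j, v i j - v i i ≤ (α - 1) / (α + 1) := by
  intro i j
  rw [le_div_iff₀ (by linarith)]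
  rcases eq_or_ne i j with rfl | hij
  · linarith
  · have hpair : v i i + v i j ≤ 1 := by
      rw [← hsum i, ← Finset.sum_pair hij]
      exact Finset.sum_le_univ_sum_of_nonneg (hnonneg i)
    linarith [hEF i j, mul_le_mul_of_nonneg_left hpair (sub_nonneg.mpr hα)]
end

section
/- Let n ≥ 2 be an integer and α ≥ 1 a real number, and let v : Fin n → Fin n → ℝ be the value matrix of an allocation (so v i j ≥ 0 for all i, j and Σ_j v i j = 1 for every i). If the allocation is α-proportional, i.e., v i i ≥ 1/(α·n) for every i, then it is (1 − 2/(α·n))-additive-EF, i.e., v i j − v i i ≤ 1 − 2/(α·n) for all i, j. -/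
/-- If an allocation (given by its value matrix) is `α`-proportional, then it is
`(1 − 2/(α·n))`-additive-EF, i.e. `v i j − v i i ≤ 1 − 2/(α·n)` for all `i, j`. -/
theorem proportional_implies_additiveEF (n : ℕ) (hn : 2 ≤ n) (α : ℝ) (hα : 1 ≤ α)
    (v : Fin n → Fin n → ℝ)
    (hnonneg : ∀ i j, 0 ≤ v i j)
    (hsum : ∀ i, ∑ j, v i j = 1)
    (hprop : ∀ i, 1 / (α * n) ≤ v i i) :
    ∀ i j, v i j - v i i ≤ 1 - 2 / (α * n) := by
  intro i j
  have hn' : (2 : ℝ) ≤ n := by exact_mod_cast hn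
  rcases eq_or_ne i j with rfl | hij
  · have h : 2 / (α * n) ≤ 1 := (div_le_one (by positivity)).2 (by nlinarith)
    linarith
  · have h : v i i + v i j ≤ 1 := by
      rw [← hsum i, ← Finset.sum_pair hij]
      exact Finset.sum_le_sum_of_subset_of_nonneg (Finset.subset_univ _)
        fun k _ _ => hnonneg i k
    have h2 : 2 / (α * n) = 2 * (1 / (α * n)) := by ring
    linarith [hprop i]
end

section
/- Let n ≥ 2 and m ≥ 2 be integers, and for each agent i ∈ Fin n let (μ_{i,k})_{k ∈ Fin m} be a family of nonatomic finite Borel measures on [0,1] with Σ_k μ_{i,k}([0,1]) = 1; write μ_i(A) = Σ_k μ_{i,k}({t ∈ [0,1] : (k,t) ∈ A}) for A ⊆ Fin m × [0,1]. Then for every real ε > 0 there exist sets A_1, …, A_n ⊆ Fin m × [0,1] such that: each A_i is star-connected; the intersection of A_i and A_j is a finite set for all i ≠ j; the union of the A_i equals Fin m × [0,1]; and (3 + ε) · μ_i(A_i) ≥ μ_i(A_j) for all i, j (i.e., the allocation is (3+ε)-EF). -/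
open MeasureTheory

/-- A subset of the star cake `Fin m × [0,1]` is star-connected if it is either a
closed subinterval of a single edge, or a union over all edges of terminal segments
`[c_k, 1]` (all meeting at the center vertex, represented by the points `(k, 1)`). -/
def StarConnected (m : ℕ) (A : Set (Fin m × ℝ)) : Prop :=
  (∃ (k : Fin m) (a b : ℝ), 0 ≤ a ∧ a ≤ b ∧ b ≤ 1 ∧
      A = ({k} : Set (Fin m)) ×ˢ Set.Icc a b) ∨
  (∃ c : Fin m → ℝ, (∀ k, c k ∈ Set.Icc (0 : ℝ) 1) ∧
      A = ⋃ k : Fin m, ({k} : Set (Fin m)) ×ˢ Set.Icc (c k) 1)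

/-- The distribution functions on the edges of a normalized nonatomic valuation. -/
structure IsValuation {m : ℕ} (F : Fin m → ℝ → ℝ) : Prop where
  continuous : ∀ k, Continuous (F k)
  monotone : ∀ k, Monotone (F k)
  zero : ∀ k, F k 0 = 0
  sum_one : ∑ k, F k 1 = 1

/-- A piece of the star cake: the segment `[left, right]` of the edge `head`, together with the
whole edges in `whole`. -/
structure StarPiece (m : ℕ) where
  head : Fin m
  left : ℝ
  right : ℝ
  whole : Finset (Fin m)

namespace StarPiece

variable {m : ℕ}

/-- A piece is valid if it is connected: whole edges occur only if the segment on the head edge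
reaches the center. -/
structure Valid (p : StarPiece m) : Prop where
  left_nonneg : 0 ≤ p.left
  left_le_right : p.left ≤ p.right
  right_le_one : p.right ≤ 1
  head_notMem : p.head ∉ p.whole
  right_eq_one : p.whole.Nonempty → p.right = 1

/-- Two pieces are compatible if they share no nondegenerate segment. -/
structure Compatible (p q : StarPiece m) : Prop where
  of_head_eq : p.head = q.head → p.right ≤ q.left ∨ q.right ≤ p.left
  head_notMem : p.head ∉ q.whole
  notMem_head : q.head ∉ p.whole
  disjoint : Disjoint p.whole q.whole

theorem Compatible.symm {p q : StarPiece m} (h : p.Compatible q) : q.Compatible p :=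
  ⟨fun e => (h.of_head_eq e.symm).symm, h.notMem_head, h.head_notMem, h.disjoint.symm⟩

/-- The value of a piece in terms of the distribution functions on the edges. -/
def value (F : Fin m → ℝ → ℝ) (p : StarPiece m) : ℝ :=
  F p.head p.right - F p.head p.left + ∑ k ∈ p.whole, F k 1

/-- The set of points of a piece; if there are whole edges, it contains every copy of the
center. -/
def toSet (p : StarPiece m) : Set (Fin m × ℝ) :=
  {z | (z.1 = p.head ∧ z.2 ∈ Set.Icc p.left p.right) ∨
    (z.1 ∈ p.whole ∧ z.2 ∈ Set.Icc (0 : ℝ) 1) ∨ (p.whole.Nonempty ∧ z.2 = 1)}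

theorem Valid.starConnected {p : StarPiece m} (hp : p.Valid) : StarConnected m p.toSet := by
  rcases p.whole.eq_empty_or_nonempty with h | h
  · left
    refine ⟨p.head, p.left, p.right, hp.left_nonneg, hp.left_le_right, hp.right_le_one, ?_⟩
    ext ⟨k, t⟩
    simp [toSet, h]
  · right
    have hr := hp.right_eq_one h
    refine ⟨fun k => if k = p.head then p.left else if k ∈ p.whole then 0 else 1, ?_, ?_⟩
    · intro k
      have := hp.left_nonneg
      have := hp.left_le_right
      have := hp.right_le_one
      dsimp only
      split_ifs <;> constructor <;> linarith
    · have hl : p.left ≤ 1 := hp.left_le_right.trans hp.right_le_one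
      have hh := hp.head_notMem
      ext ⟨k, t⟩
      simp only [toSet, Set.mem_ofPred_eq, Set.mem_iUnion, Set.mem_prod, Set.mem_singleton_iff,
        Set.mem_Icc, hr, h, true_and]
      constructor
      · intro hz
        refine ⟨k, rfl, ?_⟩
        rcases hz with ⟨rfl, h1⟩ | ⟨h1, h2⟩ | rfl
        · simpa using h1
        · have : k ≠ p.head := fun e => hh (e ▸ h1)
          simpa [this, h1] using h2
        · refine ⟨?_, le_rfl⟩
          split_ifs <;> first | exact hl | norm_num
      · rintro ⟨_, rfl, h1⟩
        split_ifs at h1 with h2 h3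
        · exact Or.inl ⟨h2, h1⟩
        · exact Or.inr (Or.inl ⟨h3, h1⟩)
        · exact Or.inr (Or.inr (le_antisymm h1.2 h1.1))

theorem Valid.toSet_subset {p : StarPiece m} (hp : p.Valid) :
    p.toSet ⊆ Set.univ ×ˢ Set.Icc (0 : ℝ) 1 := by
  rintro ⟨k, t⟩ (⟨-, h1, h2⟩ | ⟨-, h⟩ | ⟨-, h⟩)
  · exact ⟨trivial, hp.left_nonneg.trans h1, h2.trans hp.right_le_one⟩
  · exact ⟨trivial, h⟩
  · dsimp only at h
    simp [h]

theorem Compatible.finite_inter {p q : StarPiece m} (h : p.Compatible q) :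
    (p.toSet ∩ q.toSet).Finite := by
  refine ((Set.finite_univ (α := Fin m)).prod (Set.toFinite {1, p.left, q.left})).subset ?_
  rintro ⟨k, t⟩ ⟨h1, h2⟩
  refine ⟨trivial, ?_⟩
  simp only [Set.mem_insert_iff, Set.mem_singleton_iff]
  simp only [toSet, Set.mem_ofPred_eq, Set.mem_Icc] at h1 h2
  rcases h1 with ⟨e1, h1⟩ | ⟨e1, h1⟩ | ⟨-, h1⟩
  · rcases h2 with ⟨e2, h2⟩ | ⟨e2, h2⟩ | ⟨-, h2⟩
    · rcases h.of_head_eq (e1.symm.trans e2) with h3 | h3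
      · right; right; linarith
      · right; left; linarith
    · exact absurd (e1 ▸ e2) h.head_notMem
    · exact Or.inl h2
  · rcases h2 with ⟨e2, h2⟩ | ⟨e2, h2⟩ | ⟨-, h2⟩
    · exact absurd (e2 ▸ e1) h.notMem_head
    · exact absurd e2 (Finset.disjoint_left.1 h.disjoint e1)
    · exact Or.inl h2
  · exact Or.inl h1

theorem Valid.value_le_one {F : Fin m → ℝ → ℝ} (hF : IsValuation F) {p : StarPiece m}
    (hp : p.Valid) : p.value F ≤ 1 := by
  have h0 : ∀ k, 0 ≤ F k 1 := fun k => hF.zero k ▸ hF.monotone k zero_le_one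
  have h1 : F p.head p.right ≤ F p.head 1 := hF.monotone _ hp.right_le_one
  have h2 : 0 ≤ F p.head p.left := hF.zero p.head ▸ hF.monotone _ hp.left_nonneg
  have h3 : ∑ k ∈ insert p.head p.whole, F k 1 ≤ ∑ k, F k 1 :=
    Finset.sum_le_sum_of_subset_of_nonneg (Finset.subset_univ _) fun k _ _ => h0 k
  rw [Finset.sum_insert hp.head_notMem, hF.sum_one] at h3
  unfold value
  linarith

/-- A valid piece that reaches somebody's threshold `t i` can be trimmed so that it still reaches
somebody's threshold and exceeds nobody's. -/
theorem Valid.exists_trim {n : ℕ} {F : Fin n → Fin m → ℝ → ℝ} (hF : ∀ i, IsValuation (F i))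
    {t : Fin n → ℝ} (ht : ∀ i, 0 < t i) {p : StarPiece m} (hp : p.Valid)
    (hpt : ∃ i, t i ≤ p.value (F i)) :
    ∃ q : StarPiece m, q.Valid ∧ q.left < q.right ∧ (∀ r, p.Compatible r → q.Compatible r) ∧
      (∃ i, t i ≤ q.value (F i)) ∧ ∀ i, q.value (F i) ≤ t i := by
  induction hc : p.whole.card using Nat.strong_induction_on generalizing p with
  | _ N ih
  by_cases hw : ∃ i, t i ≤ ∑ k ∈ p.whole, F i k 1
  · obtain ⟨i, hi⟩ := hw
    obtain ⟨k, hk⟩ : p.whole.Nonempty := by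
      by_contra! h
      rw [h, Finset.sum_empty] at hi
      exact absurd hi (not_le.2 (ht i))
    have hval : ∀ j, (⟨k, 0, 1, p.whole.erase k⟩ : StarPiece m).value (F j)
        = ∑ l ∈ p.whole, F j l 1 := by
      intro j
      rw [← Finset.add_sum_erase _ _ hk]
      simp [value, (hF j).zero]
    obtain ⟨q, h1, h2, h3, h4⟩ := ih _ (hc ▸ Finset.card_erase_lt_of_mem hk)
      (p := ⟨k, 0, 1, p.whole.erase k⟩)
      ⟨le_rfl, zero_le_one, le_rfl, by simp, fun _ => rfl⟩ ⟨i, by rw [hval]; exact hi⟩ rfl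
    refine ⟨q, h1, h2, fun r hr => h3 r ⟨?_, ?_, ?_, ?_⟩, h4⟩
    · intro e
      exact absurd (e ▸ hk) hr.notMem_head
    · exact Finset.disjoint_left.1 hr.disjoint hk
    · exact fun h => hr.notMem_head (Finset.mem_of_mem_erase h)
    · exact hr.disjoint.mono_left (Finset.erase_subset _ _)
  · push Not at hw
    obtain ⟨i₀, hi₀⟩ := hpt
    let g : ℝ → ℝ := fun x => Finset.univ.sup' ⟨i₀, Finset.mem_univ _⟩
      fun i => (⟨p.head, x, p.right, p.whole⟩ : StarPiece m).value (F i) - t i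
    have hg : Continuous g := by
      refine Continuous.finset_sup'_apply _ fun i _ => ?_
      have := (hF i).continuous p.head
      dsimp only [value]
      fun_prop
    have hgl : 0 ≤ g p.left :=
      (sub_nonneg.2 hi₀).trans (Finset.le_sup' (fun i =>
        (⟨p.head, p.left, p.right, p.whole⟩ : StarPiece m).value (F i) - t i)
        (Finset.mem_univ i₀))
    have hgr : g p.right < 0 := by
      refine (Finset.sup'_lt_iff _).2 fun i _ => ?_
      simpa [value] using hw i
    obtain ⟨x, hx, hgx⟩ := intermediate_value_Icc' hp.left_le_right hg.continuousOn
      (show (0 : ℝ) ∈ Set.Icc (g p.right) (g p.left) from ⟨hgr.le, hgl⟩)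
    have hxr : x < p.right := lt_of_le_of_ne hx.2 fun e => by rw [← e, hgx] at hgr; simp at hgr
    refine ⟨⟨p.head, x, p.right, p.whole⟩, ⟨hp.left_nonneg.trans hx.1, hx.2, hp.right_le_one,
      hp.head_notMem, hp.right_eq_one⟩, hxr, fun r hr => ⟨fun e => ?_, hr.head_notMem,
      hr.notMem_head, hr.disjoint⟩, ?_, fun i => ?_⟩
    · exact (hr.of_head_eq e).imp id fun h => h.trans hx.1
    · obtain ⟨i, -, hi⟩ := Finset.exists_mem_eq_sup' (s := Finset.univ) ⟨i₀, Finset.mem_univ _⟩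
        fun i => (⟨p.head, x, p.right, p.whole⟩ : StarPiece m).value (F i) - t i
      exact ⟨i, by have : g x = _ := hi; linarith⟩
    · have : _ ≤ g x := Finset.le_sup' (fun i =>
        (⟨p.head, x, p.right, p.whole⟩ : StarPiece m).value (F i) - t i) (Finset.mem_univ i)
      linarith

end StarPiece

/-- A partial allocation, in which agent `i` is served once `0 < c i`; then she holds a
nondegenerate piece worth at least `δ * c i` to her, and no served piece is worth more than
`δ * (c i + 1)` to her. -/
structure IsPartialAllocation {n m : ℕ} (F : Fin n → Fin m → ℝ → ℝ) (δ : ℝ)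
    (A : Fin n → StarPiece m) (c : Fin n → ℕ) : Prop where
  valid : ∀ i, 0 < c i → (A i).Valid
  left_lt_right : ∀ i, 0 < c i → (A i).left < (A i).right
  compatible : ∀ i j, i ≠ j → 0 < c i → 0 < c j → (A i).Compatible (A j)
  le_value : ∀ i, 0 < c i → δ * c i ≤ (A i).value (F i)
  value_le : ∀ i j, 0 < c j → (A j).value (F i) ≤ δ * (c i + 1)

/-- There is a partial allocation such that no agent `i` values any unassigned valid piece more
than `δ * (c i + 1)`. -/
theorem exists_saturated_isPartialAllocation {n m : ℕ} (hm : 0 < m) {F : Fin n → Fin m → ℝ → ℝ}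
    (hF : ∀ i, IsValuation (F i)) {δ : ℝ} (hδ : 0 < δ) :
    ∃ A c, IsPartialAllocation F δ A c ∧
      ∀ p : StarPiece m, p.Valid → (∀ j, 0 < c j → p.Compatible (A j)) →
        ∀ i, p.value (F i) ≤ δ * (c i + 1) := by
  let P : ℕ → Prop := fun N => ∃ A c, IsPartialAllocation F δ A c ∧ ∑ i, c i = N
  have hP0 : P 0 := ⟨fun _ => ⟨⟨0, hm⟩, 0, 0, ∅⟩, fun _ => 0,
    ⟨by simp, by simp, by simp, by simp, by simp⟩, by simp⟩
  have hbound : ∀ N, P N → N ≤ n * ⌊1 / δ⌋₊ := by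
    rintro N ⟨A, c, hA, rfl⟩
    calc ∑ i, c i ≤ ∑ _i : Fin n, ⌊1 / δ⌋₊ := by
          refine Finset.sum_le_sum fun i _ => ?_
          rcases Nat.eq_zero_or_pos (c i) with h | h
          · simp [h]
          · refine Nat.le_floor ((le_div_iff₀ hδ).2 ?_)
            have := hA.le_value i h
            have := (hA.valid i h).value_le_one (hF i)
            linarith
      _ = _ := by simp
  obtain ⟨N, ⟨A, c, hA, hN⟩, hmax⟩ : ∃ N, P N ∧ ∀ M, P M → M ≤ N := by
    classical
    refine ⟨Nat.findGreatest P (n * ⌊1 / δ⌋₊), Nat.findGreatest_spec (Nat.zero_le _) hP0,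
      fun M hM => Nat.le_findGreatest (hbound M hM) hM⟩
  refine ⟨A, c, hA, fun p hp hcomp i => ?_⟩
  by_contra! hlt
  obtain ⟨q, hq, hlr, hqc, ⟨j, hj⟩, hle⟩ := hp.exists_trim hF
    (t := fun i => δ * (c i + 1)) (fun i => by positivity) ⟨i, hlt.le⟩
  have hmono : ∀ k, c k ≤ Function.update c j (c j + 1) k := by
    intro k
    by_cases h : k = j
    · subst h; simp
    · simp [h]
  have hmono' : ∀ k, δ * (c k + 1) ≤ δ * ((Function.update c j (c j + 1) k : ℕ) + 1) := by
    intro k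
    have : (c k : ℝ) ≤ (Function.update c j (c j + 1) k : ℕ) := by exact_mod_cast hmono k
    gcongr
  have hnew : P (N + 1) := by
    refine ⟨Function.update A j q, Function.update c j (c j + 1),
      ⟨fun k hk => ?_, fun k hk => ?_, fun k l hkl hk hl => ?_, fun k hk => ?_,
        fun k l hl => (le_trans ?_ (hmono' k))⟩, ?_⟩
    · by_cases h : k = j
      · subst h; simpa using hq
      · simp only [Function.update_of_ne h] at hk ⊢
        exact hA.valid k hk
    · by_cases h : k = j
      · subst h; simpa using hlr
      · simp only [Function.update_of_ne h] at hk ⊢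
        exact hA.left_lt_right k hk
    · by_cases h : k = j
      · subst h
        simp only [Function.update_of_ne hkl.symm, Function.update_self] at hl ⊢
        exact hqc _ (hcomp l hl)
      · by_cases h' : l = j
        · subst h'
          simp only [Function.update_of_ne h, Function.update_self] at hk ⊢
          exact (hqc _ (hcomp k hk)).symm
        · simp only [Function.update_of_ne h, Function.update_of_ne h'] at hk hl ⊢
          exact hA.compatible k l hkl hk hl
    · by_cases h : k = j
      · subst h; simpa using hj
      · simp only [Function.update_of_ne h] at hk ⊢
        exact hA.le_value k hk
    · by_cases h : l = j
      · subst h; simpa using hle k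
      · simp only [Function.update_of_ne h] at hl ⊢
        exact hA.value_le k l hl
    · rw [Finset.sum_update_of_mem (Finset.mem_univ j), ← hN,
        ← Finset.add_sum_erase _ _ (Finset.mem_univ j), Finset.sdiff_singleton_eq_erase]
      ring
  have := hmax _ hnew
  omega

/-- The pieces of a saturated partial allocation can be enlarged to cover the cake, in such a way
that agent `i` values no enlarged piece more than `3 * (δ * (c i + 1))`. -/
theorem exists_cover_of_saturated {n m : ℕ} (hn : 0 < n) (hm : 0 < m) {F : Fin n → Fin m → ℝ → ℝ}
    (hF : ∀ i, IsValuation (F i)) {δ : ℝ} (hδ : δ < 1) {A : Fin n → StarPiece m}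
    {c : Fin n → ℕ} (hA : IsPartialAllocation F δ A c)
    (hsat : ∀ p : StarPiece m, p.Valid → (∀ j, 0 < c j → p.Compatible (A j)) →
        ∀ i, p.value (F i) ≤ δ * (c i + 1)) :
    ∃ B : Fin n → StarPiece m, (∀ i, 0 < c i → (B i).Valid) ∧
      (∀ i j, i ≠ j → 0 < c i → 0 < c j → (B i).Compatible (B j)) ∧
      (∀ k, ∀ t ∈ Set.Icc (0 : ℝ) 1, ∃ i, 0 < c i ∧ (k, t) ∈ (B i).toSet) ∧
      (∀ i j, 0 < c j → (A j).value (F i) ≤ (B j).value (F i)) ∧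
      (∀ i j, 0 < c j → (B j).value (F i) ≤ 3 * (δ * (c i + 1))) := by
  classical
  let S : Finset (Fin n) := {i | 0 < c i}
  have hS : ∀ i, i ∈ S ↔ 0 < c i := fun i => by simp [S]
  have hSne : S.Nonempty := by
    by_contra! hemp
    have hc : ∀ i, ¬ 0 < c i := fun i h => by simpa [hemp] using (hS i).2 h
    have h0 := hsat ⟨⟨0, hm⟩, 0, 1, Finset.univ.erase ⟨0, hm⟩⟩
      ⟨le_rfl, zero_le_one, le_rfl, by simp, fun _ => rfl⟩ (fun j hj => absurd hj (hc j)) ⟨0, hn⟩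
    have h1 : c ⟨0, hn⟩ = 0 := Nat.eq_zero_of_not_pos (hc _)
    simp only [StarPiece.value, (hF _).zero, sub_zero,
      Finset.add_sum_erase Finset.univ (fun k => F ⟨0, hn⟩ k 1) (Finset.mem_univ _),
      (hF _).sum_one, h1] at h0
    norm_num at h0
    linarith
  obtain ⟨s, hsS, hs⟩ := S.exists_max_image (fun i => (A i).left) hSne
  let E : Finset (Fin m) := {k | ∀ j, 0 < c j → (A j).head ≠ k ∧ k ∉ (A j).whole}
  have hE : ∀ k, k ∈ E ↔ ∀ j, 0 < c j → (A j).head ≠ k ∧ k ∉ (A j).whole := fun k => by simp [E]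
  let after : Fin n → Finset (Fin n) := fun i =>
    {j | 0 < c j ∧ (A j).head = (A i).head ∧ (A i).left < (A j).left}
  have hafter : ∀ i j, j ∈ after i ↔
      0 < c j ∧ (A j).head = (A i).head ∧ (A i).left < (A j).left := fun i j => by simp [after]
  let r : Fin n → ℝ := fun i => (insert 1 ((after i).image fun j => (A j).left)).min'
    (Finset.insert_nonempty _ _)
  have hr1 : ∀ i, r i ≤ 1 := fun i => Finset.min'_le _ _ (by simp)
  have hrle : ∀ i j, 0 < c j → (A j).head = (A i).head → (A i).left < (A j).left →
      r i ≤ (A j).left := fun i j h1 h2 h3 =>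
    Finset.min'_le _ _ (Finset.mem_insert_of_mem
      (Finset.mem_image_of_mem _ ((hafter i j).2 ⟨h1, h2, h3⟩)))
  have hler : ∀ i z, z ≤ 1 → (∀ j, 0 < c j → (A j).head = (A i).head →
      (A i).left < (A j).left → z ≤ (A j).left) → z ≤ r i := by
    intro i z h1 h2
    refine Finset.le_min' _ _ _ fun y hy => ?_
    simp only [Finset.mem_insert, Finset.mem_image] at hy
    rcases hy with rfl | ⟨j, hj, rfl⟩
    · exact h1
    · obtain ⟨a, b, d⟩ := (hafter i j).1 hj
      exact h2 j a b d
  let l : Fin n → ℝ := fun i =>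
    if ∃ j, 0 < c j ∧ (A j).head = (A i).head ∧ (A j).left < (A i).left then (A i).left else 0
  let W : Fin n → Finset (Fin m) := fun i => if i = s then E else ∅
  have hWE : ∀ i, W i ⊆ E := fun i => by dsimp only [W]; split_ifs <;> simp
  have hsep : ∀ i j, 0 < c i → 0 < c j → (A j).head = (A i).head → (A i).left < (A j).left →
      (A i).right ≤ (A j).left := by
    intro i j hi hj h1 h2
    have hij : i ≠ j := by rintro rfl; exact lt_irrefl _ h2
    rcases (hA.compatible i j hij hi hj).of_head_eq h1.symm with h | h
    · exact h
    · have := hA.left_lt_right j hj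
      linarith
  have hne : ∀ i j, i ≠ j → 0 < c i → 0 < c j → (A i).head = (A j).head →
      (A i).left < (A j).left ∨ (A j).left < (A i).left := by
    intro i j hij hi hj h1
    rcases (hA.compatible i j hij hi hj).of_head_eq h1 with h | h
    · exact Or.inl ((hA.left_lt_right i hi).trans_le h)
    · exact Or.inr ((hA.left_lt_right j hj).trans_le h)
  have hyr : ∀ i, 0 < c i → (A i).right ≤ r i := fun i hi =>
    hler i _ (hA.valid i hi).right_le_one fun j hj h1 h2 => hsep i j hi hj h1 h2
  have hl0 : ∀ i, 0 < c i → 0 ≤ l i := fun i hi => by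
    dsimp only [l]; split_ifs
    · exact (hA.valid i hi).left_nonneg
    · exact le_rfl
  have hlx : ∀ i, 0 < c i → l i ≤ (A i).left := fun i hi => by
    dsimp only [l]; split_ifs
    · exact le_rfl
    · exact (hA.valid i hi).left_nonneg
  have hWr : ∀ i, (W i).Nonempty → r i = 1 := by
    intro i hi
    have his : i = s := by
      by_contra h
      simp [W, h] at hi
    subst his
    refine le_antisymm (hr1 _) (hler _ _ le_rfl fun j hj _ h => ?_)
    exact absurd (hs j ((hS j).2 hj)) (not_le.2 h)
  have hEhead : ∀ i k, 0 < c i → k ∈ E → (A i).head ≠ k := fun i k hi hk => ((hE k).1 hk i hi).1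
  have hEwhole : ∀ i, 0 < c i → Disjoint E (A i).whole := fun i hi =>
    Finset.disjoint_left.2 fun k hk => ((hE k).1 hk i hi).2
  have hhead : ∀ i j, 0 < c i → 0 < c j → (A i).head ∉ (A j).whole := by
    intro i j hi hj
    by_cases h : i = j
    · subst h; exact (hA.valid i hi).head_notMem
    · exact (hA.compatible i j h hi hj).head_notMem
  have hright : ∀ i a, 0 < c i →
      (⟨(A i).head, (A i).right, r i, W i⟩ : StarPiece m).value (F a) ≤ δ * (c a + 1) := by
    intro i a hi
    have hv := hA.valid i hi
    refine hsat ⟨(A i).head, (A i).right, r i, W i⟩ ⟨hv.left_nonneg.trans hv.left_le_right, hyr i hi, hr1 i,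
      fun h => hEhead i _ hi (hWE i h) rfl, hWr i⟩ (fun j hj => ⟨fun e => ?_, hhead i j hi hj,
      fun h => hEhead j _ hj (hWE i h) rfl, (hEwhole j hj).mono_left (hWE i)⟩) a
    by_cases hij : i = j
    · subst hij; exact Or.inr le_rfl
    · rcases hne i j hij hi hj e with h | h
      · exact Or.inl (hrle i j hj e.symm h)
      · exact Or.inr ((hsep j i hj hi e h).trans hv.left_le_right)
  have hleft : ∀ i a, 0 < c i →
      (⟨(A i).head, l i, (A i).left, ∅⟩ : StarPiece m).value (F a) ≤ δ * (c a + 1) := by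
    intro i a hi
    have hv := hA.valid i hi
    refine hsat ⟨(A i).head, l i, (A i).left, ∅⟩ ⟨hl0 i hi, hlx i hi, hv.left_le_right.trans hv.right_le_one,
      Finset.notMem_empty _, fun h => absurd h Finset.not_nonempty_empty⟩
      (fun j hj => ⟨fun e => ?_, hhead i j hi hj, Finset.notMem_empty _,
        Finset.disjoint_empty_left _⟩) a
    by_cases hij : i = j
    · subst hij; exact Or.inl le_rfl
    · rcases hne i j hij hi hj e with h | h
      · exact Or.inl h.le
      · right
        have : l i = (A i).left := if_pos ⟨j, hj, e.symm, h⟩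
        dsimp only
        rw [this]
        exact hsep j i hj hi e h
  have hval : ∀ i a, 0 < c i →
      (⟨(A i).head, l i, r i, (A i).whole ∪ W i⟩ : StarPiece m).value (F a) =
      (A i).value (F a) + (⟨(A i).head, (A i).right, r i, W i⟩ : StarPiece m).value (F a) +
      (⟨(A i).head, l i, (A i).left, ∅⟩ : StarPiece m).value (F a) := by
    intro i a hi
    simp only [StarPiece.value,
      Finset.sum_union ((hEwhole i hi).mono_left (hWE i)).symm, Finset.sum_empty]
    ring
  refine ⟨fun i => ⟨(A i).head, l i, r i, (A i).whole ∪ W i⟩, fun i hi => ?_,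
    fun i j hij hi hj => ?_, fun k t ht => ?_, fun a i hi => ?_, fun a i hi => ?_⟩
  · have hv := hA.valid i hi
    refine ⟨hl0 i hi, (hlx i hi).trans (hv.left_le_right.trans (hyr i hi)), hr1 i, ?_, ?_⟩
    · simp only [Finset.mem_union, not_or]
      exact ⟨hv.head_notMem, fun h => hEhead i _ hi (hWE i h) rfl⟩
    · intro h
      rcases Finset.union_nonempty.1 h with h | h
      · exact le_antisymm (hr1 i) ((hv.right_eq_one h).symm.trans_le (hyr i hi))
      · exact hWr i h
  · have hc := hA.compatible i j hij hi hj
    refine ⟨fun e => ?_, ?_, ?_, ?_⟩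
    · dsimp only at e ⊢
      rcases hne i j hij hi hj e with h | h
      · left
        have : l j = (A j).left := if_pos ⟨i, hi, e, h⟩
        rw [this]
        exact hrle i j hj e.symm h
      · right
        have : l i = (A i).left := if_pos ⟨j, hj, e.symm, h⟩
        rw [this]
        exact hrle j i hi e h
    · simp only [Finset.mem_union, not_or]
      exact ⟨hc.head_notMem, fun h => hEhead i _ hi (hWE j h) rfl⟩
    · simp only [Finset.mem_union, not_or]
      exact ⟨hc.notMem_head, fun h => hEhead j _ hj (hWE i h) rfl⟩
    · simp only [Finset.disjoint_union_left, Finset.disjoint_union_right]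
      refine ⟨⟨hc.disjoint, (hEwhole j hj).mono_left (hWE i)⟩,
        ((hEwhole i hi).mono_left (hWE j)).symm, ?_⟩
      by_cases h : i = s
      · have : j ≠ s := fun h' => hij (h.trans h'.symm)
        simp [W, this]
      · simp [W, h]
  · by_cases hk : k ∈ E
    · exact ⟨s, (hS s).1 hsS, Or.inr (Or.inl ⟨by simp [W, hk], ht⟩)⟩
    · simp only [hE, not_forall, not_and_or, not_not] at hk
      obtain ⟨j, hj, rfl | hk⟩ := hk
      · let T : Finset (Fin n) := {i | 0 < c i ∧ (A i).head = (A j).head}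
        have hT : ∀ i, i ∈ T ↔ 0 < c i ∧ (A i).head = (A j).head := fun i => by simp [T]
        have hjT : j ∈ T := (hT j).2 ⟨hj, rfl⟩
        by_cases hlow : ∃ i ∈ T, (A i).left ≤ t
        · obtain ⟨i, hi, hmax⟩ := (T.filter fun i => (A i).left ≤ t).exists_max_image
            (fun i => (A i).left) (by
              obtain ⟨i, hi, h⟩ := hlow
              exact ⟨i, Finset.mem_filter.2 ⟨hi, h⟩⟩)
          rw [Finset.mem_filter] at hi
          obtain ⟨h1, h2⟩ := (hT i).1 hi.1
          refine ⟨i, h1, Or.inl ⟨h2.symm, (hlx i h1).trans hi.2, ?_⟩⟩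
          refine hler i t ht.2 fun a ha h3 h4 => ?_
          by_contra! h5
          exact absurd (hmax a (Finset.mem_filter.2 ⟨(hT a).2 ⟨ha, h3.trans h2⟩, h5.le⟩))
            (not_le.2 h4)
        · push Not at hlow
          obtain ⟨i, hi, hmin⟩ := T.exists_min_image (fun i => (A i).left) ⟨j, hjT⟩
          obtain ⟨h1, h2⟩ := (hT i).1 hi
          have hv := hA.valid i h1
          refine ⟨i, h1, Or.inl ⟨h2.symm, ?_, ?_⟩⟩
          · have : l i = 0 := if_neg fun ⟨a, ha, h3, h4⟩ =>
              absurd (hmin a ((hT a).2 ⟨ha, h3.trans h2⟩)) (not_le.2 h4)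
            dsimp only
            rw [this]
            exact ht.1
          · exact (hlow i hi).le.trans (hv.left_le_right.trans (hyr i h1))
      · exact ⟨j, hj, Or.inr (Or.inl ⟨Finset.mem_union_left _ hk, ht⟩)⟩
  · rw [hval i a hi]
    have h1 : F a (A i).head (A i).right ≤ F a (A i).head (r i) := (hF a).monotone _ (hyr i hi)
    have h2 : F a (A i).head (l i) ≤ F a (A i).head (A i).left := (hF a).monotone _ (hlx i hi)
    have h3 : 0 ≤ ∑ k ∈ W i, F a k 1 := Finset.sum_nonneg fun k _ =>
      (hF a).zero k ▸ (hF a).monotone k zero_le_one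
    have : ∀ p : StarPiece m, p.value (F a) =
      F a p.head p.right - F a p.head p.left + ∑ k ∈ p.whole, F a k 1 := fun _ => rfl
    rw [this ⟨_, _, r i, _⟩, this ⟨_, l i, (A i).left, _⟩]
    simp only [Finset.sum_empty]
    linarith
  · rw [hval i a hi]
    have := hright i a hi
    have := hleft i a hi
    have := hA.value_le a i hi
    linarith

/-- The distribution function of a finite measure on the half-line `[0, ∞)`. -/
noncomputable def distribution (ν : Measure ℝ) (t : ℝ) : ℝ := ∫ _ in (0 : ℝ)..t, (1 : ℝ) ∂ν

theorem distribution_sub (ν : Measure ℝ) [IsFiniteMeasure ν] [NullSingletonClass ν] {a b : ℝ} (hab : a ≤ b) :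
    distribution ν b - distribution ν a = (ν (Set.Icc a b)).toReal := by
  have hint : ∀ x y, IntervalIntegrable (fun _ => (1 : ℝ)) ν x y := fun x y =>
    intervalIntegrable_const
  rw [distribution, distribution, intervalIntegral.integral_interval_sub_left (hint _ _) (hint _ _),
    intervalIntegral.integral_of_le hab, setIntegral_const, smul_eq_mul, mul_one, measureReal_def,
    Ioc_ae_eq_Icc.measure_eq]

theorem isValuation_distribution {m : ℕ} (μ : Fin m → Measure ℝ) [∀ k, IsFiniteMeasure (μ k)]
    [∀ k, NullSingletonClass (μ k)] (hnorm : ∑ k, (μ k (Set.Icc (0 : ℝ) 1)).toReal = 1) :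
    IsValuation fun k => distribution (μ k) where
  continuous k := intervalIntegral.continuous_primitive (fun _ _ => intervalIntegrable_const) 0
  monotone k a b hab := by
    have := distribution_sub (μ k) hab
    have : 0 ≤ (μ k (Set.Icc a b)).toReal := ENNReal.toReal_nonneg
    linarith
  zero k := by simp [distribution]
  sum_one := by
    refine (Finset.sum_congr rfl fun k _ => ?_).trans hnorm
    rw [← distribution_sub (μ k) zero_le_one]
    simp [distribution]

theorem StarPiece.Valid.sum_measure_eq_value {m : ℕ} (μ : Fin m → Measure ℝ)
    [∀ k, IsFiniteMeasure (μ k)] [∀ k, NullSingletonClass (μ k)] {p : StarPiece m} (hp : p.Valid) :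
    ∑ k, (μ k {t ∈ Set.Icc (0 : ℝ) 1 | (k, t) ∈ p.toSet}).toReal =
      p.value fun k => distribution (μ k) := by
  let T : Fin m → Set ℝ := fun k =>
    if k = p.head then Set.Icc p.left p.right else if k ∈ p.whole then Set.Icc 0 1 else ∅
  have hTs : ∀ k, μ k {t ∈ Set.Icc (0 : ℝ) 1 | (k, t) ∈ p.toSet} = μ k (T k) := by
    intro k
    apply le_antisymm
    · refine (measure_mono (t := T k ∪ {1}) ?_).trans (measure_union_le _ _ |>.trans_eq (by simp))
      rintro t ⟨-, ⟨h1, h2⟩ | ⟨h1, h2⟩ | ⟨-, h2⟩⟩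
      · exact Or.inl (by simpa [T, show k = p.head from h1] using h2)
      · have : k ≠ p.head := fun e => hp.head_notMem (e ▸ h1)
        exact Or.inl (by simpa [T, this, show k ∈ p.whole from h1] using h2)
      · exact Or.inr h2
    · refine measure_mono fun t ht => ?_
      have : (k, t) ∈ p.toSet := by
        dsimp only [T] at ht
        split_ifs at ht with h1 h2
        · exact Or.inl ⟨h1, ht⟩
        · exact Or.inr (Or.inl ⟨h2, ht⟩)
        · exact ht.elim
      exact ⟨(hp.toSet_subset this).2, this⟩
  simp only [hTs]
  rw [← Finset.add_sum_erase _ _ (Finset.mem_univ p.head), StarPiece.value,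
    distribution_sub (μ p.head) hp.left_le_right]
  congr 1
  · simp [T]
  · rw [← Finset.sum_subset (s₁ := p.whole)]
    · refine Finset.sum_congr rfl fun k hk => ?_
      have : k ≠ p.head := fun e => hp.head_notMem (e ▸ hk)
      simp only [T, this, hk, if_true, if_false]
      rw [← distribution_sub (μ k) zero_le_one]
      simp [distribution]
    · intro k hk
      simpa using ne_of_mem_of_not_mem hk hp.head_notMem
    · intro k hk hk'
      have : k ≠ p.head := by simpa using hk
      simp [T, this, hk']

/-- For any `n ≥ 2` agents with (possibly distinct) nonatomic normalized valuations over a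
star cake with `m ≥ 2` edges, and any `ε > 0`, there exists a connected allocation of the
star cake that is `(3 + ε)`-envy-free. -/
theorem star_three_plus_eps_EF (n m : ℕ) (hn : 2 ≤ n) (hm : 2 ≤ m)
    (μ : Fin n → Fin m → Measure ℝ)
    (hfin : ∀ i k, IsFiniteMeasure (μ i k))
    (hnonatomic : ∀ i k (x : ℝ), μ i k {x} = 0)
    (hnorm : ∀ i, ∑ k, (μ i k (Set.Icc (0 : ℝ) 1)).toReal = 1)
    (ε : ℝ) (hε : 0 < ε) :
    ∃ A : Fin n → Set (Fin m × ℝ),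
      (∀ i, StarConnected m (A i)) ∧
      (∀ i j, i ≠ j → (A i ∩ A j).Finite) ∧
      (⋃ i, A i) = (Set.univ : Set (Fin m)) ×ˢ Set.Icc (0 : ℝ) 1 ∧
      (∀ i j, ∑ k, (μ i k {t ∈ Set.Icc (0 : ℝ) 1 | (k, t) ∈ A j}).toReal ≤
        (3 + ε) * ∑ k, (μ i k {t ∈ Set.Icc (0 : ℝ) 1 | (k, t) ∈ A i}).toReal) := by
  have hatoms : ∀ i k, NullSingletonClass (μ i k) := fun i k => ⟨hnonatomic i k⟩
  let F : Fin n → Fin m → ℝ → ℝ := fun i k => distribution (μ i k)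
  have hF : ∀ i, IsValuation (F i) := fun i => isValuation_distribution (μ i) (hnorm i)
  have hn' : (2 : ℝ) ≤ n := by exact_mod_cast hn
  obtain ⟨δ, hδ0, hδ1, hδ⟩ : ∃ δ : ℝ, 0 < δ ∧ δ < 1 ∧ n * (3 * (δ * (3 / ε + 1))) = 1 := by
    have h3 : 0 < 3 / ε := by positivity
    refine ⟨1 / (n * (3 * (3 / ε + 1))), by positivity, ?_, by field_simp⟩
    rw [div_lt_one (by positivity)]
    nlinarith
  obtain ⟨A, c, hA, hsat⟩ := exists_saturated_isPartialAllocation (by omega) hF hδ0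
  obtain ⟨B, hvalid, hcomp, hcover, hge, hle⟩ :=
    exists_cover_of_saturated (by omega) (by omega) hF hδ1 hA hsat
  have hlarge : ∀ i, 3 / ε ≤ c i := by
    intro i
    let S : Finset (Fin n) := {j | 0 < c j}
    have hS : ∀ j, j ∈ S ↔ 0 < c j := fun j => by simp [S]
    have h1 : (1 : ℝ) ≤ ∑ j ∈ S, (B j).value (F i) := by
      calc (1 : ℝ) = ∑ k, (μ i k).real (Set.Icc (0 : ℝ) 1) := (hnorm i).symm
        _ ≤ ∑ k, ∑ j ∈ S, (μ i k).real {t ∈ Set.Icc (0 : ℝ) 1 | (k, t) ∈ (B j).toSet} := by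
          refine Finset.sum_le_sum fun k _ => le_trans (measureReal_mono ?_ (measure_ne_top _ _))
            (measureReal_biUnion_finset_le S _)
          intro t ht
          obtain ⟨j, hj, hjt⟩ := hcover k t ht
          exact Set.mem_biUnion (show j ∈ (S : Set (Fin n)) from (hS j).2 hj) ⟨ht, hjt⟩
        _ = ∑ j ∈ S, ∑ k, (μ i k).real {t ∈ Set.Icc (0 : ℝ) 1 | (k, t) ∈ (B j).toSet} :=
          Finset.sum_comm
        _ = _ := Finset.sum_congr rfl fun j hj =>
          (hvalid j ((hS j).1 hj)).sum_measure_eq_value (μ i)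
    have h2 : ∑ j ∈ S, (B j).value (F i) ≤ n * (3 * (δ * (c i + 1))) := by
      calc ∑ j ∈ S, (B j).value (F i) ≤ ∑ _j ∈ S, 3 * (δ * (c i + 1)) :=
            Finset.sum_le_sum fun j hj => hle i j ((hS j).1 hj)
        _ = S.card * (3 * (δ * (c i + 1))) := by rw [Finset.sum_const, nsmul_eq_mul]
        _ ≤ _ := by
          have : S.card ≤ n := by simpa using S.card_le_univ
          gcongr
    have h3 : n * (3 * (δ * (3 / ε + 1))) ≤ n * (3 * (δ * (c i + 1))) := by linarith
    have h4 := le_of_mul_le_mul_left h3 (by linarith)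
    have h5 := le_of_mul_le_mul_left h4 (by norm_num)
    have h6 := le_of_mul_le_mul_left h5 hδ0
    linarith
  have hpos : ∀ i, 0 < c i := fun i => by
    have : (0 : ℝ) < c i := lt_of_lt_of_le (by positivity) (hlarge i)
    exact_mod_cast this
  refine ⟨fun i => (B i).toSet, fun i => (hvalid i (hpos i)).starConnected,
    fun i j hij => (hcomp i j hij (hpos i) (hpos j)).finite_inter, ?_, fun i j => ?_⟩
  · refine Set.Subset.antisymm (Set.iUnion_subset fun i => (hvalid i (hpos i)).toSet_subset) ?_
    rintro ⟨k, t⟩ ⟨-, ht⟩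
    obtain ⟨i, -, hi⟩ := hcover k t ht
    exact Set.mem_iUnion.2 ⟨i, hi⟩
  · rw [(hvalid j (hpos j)).sum_measure_eq_value (μ i),
      (hvalid i (hpos i)).sum_measure_eq_value (μ i)]
    have h1 := hle i j (hpos j)
    have h2 := hge i i (hpos i)
    have h3 := hA.le_value i (hpos i)
    have h4 : 3 ≤ ε * c i := by
      have := (div_le_iff₀ hε).1 (hlarge i)
      linarith
    have h5 : δ * 3 ≤ δ * (ε * c i) := by gcongr
    calc (B j).value (F i) ≤ 3 * (δ * (c i + 1)) := h1
      _ ≤ (3 + ε) * (δ * c i) := by linarith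
      _ ≤ (3 + ε) * (B i).value (F i) := by gcongr; exact h3.trans h2
end

section
/- Let n ≥ 2 and m ≥ 1 be integers, and let (μ_k)_{k ∈ Fin m} be a family of nonatomic finite Borel measures on [0,1] with Σ_k μ_k([0,1]) = 1; write μ(A) = Σ_k μ_k({t ∈ [0,1] : (k,t) ∈ A}) for A ⊆ Fin m × [0,1]. Then there exist sets A_1, …, A_n ⊆ Fin m × [0,1] such that: each A_i is star-connected; the intersection of A_i and A_j is a finite set for all i ≠ j; the union of the A_i equals Fin m × [0,1]; and 2 · μ(A_i) ≥ μ(A_j) for all i, j (i.e., the allocation of the star cake among n agents with identical valuation μ is 2-EF). -/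
open MeasureTheory

section Combinatorics

open Finset Filter Topology

variable {ι κ : Type*} [Fintype ι] [DecidableEq κ]

/-- The number of shares cut off from the outer end of edge `k`, when `e j = some k` says that
share `j` is such a piece of edge `k`. -/
def pieceCount (e : ι → Option κ) (k : κ) : ℕ := #{j | e j = some k}

/-- The value left on edge `k` after all pieces of value `q` have been cut off. -/
def remainder (v : κ → ℝ) (q : ℝ) (e : ι → Option κ) (k : κ) : ℝ := v k - pieceCount e k * q

lemma continuous_remainder (v : κ → ℝ) (e : ι → Option κ) (k : κ) :
    Continuous fun q => remainder v q e k := by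
  unfold remainder
  fun_prop

/-- The pieces of each edge can be numbered consecutively from `0`. -/
lemma exists_piece_numbering (e : ι → Option κ) :
    ∃ r : ι → ℕ, (∀ j k, e j = some k → r j < pieceCount e k) ∧
      (∀ i j k, e i = some k → e j = some k → r i = r j → i = j) ∧
      ∀ k, ∀ i < pieceCount e k, ∃ j, e j = some k ∧ r j = i := by
  classical
  let σ := fun k => ({j | e j = some k} : Finset ι).equivFin
  let r : ι → ℕ := fun j => if h : ∃ k, e j = some k then
    σ h.choose ⟨j, by simpa using h.choose_spec⟩ else 0
  have hr : ∀ j k (h : e j = some k), r j = σ k ⟨j, by simpa using h⟩ := by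
    intro j k h
    have hex : ∃ k, e j = some k := ⟨k, h⟩
    have hk : ∀ k' (h' : e j = some k'),
        (σ k' ⟨j, by simpa using h'⟩ : ℕ) = σ k ⟨j, by simpa using h⟩ := by
      intro k' h'
      obtain rfl : k' = k := by simpa [h'] using h
      rfl
    simp only [r, dif_pos hex]
    exact hk _ hex.choose_spec
  refine ⟨r, fun j k h => ?_, fun i j k hi hj hij => ?_, fun k i hi => ?_⟩
  · rw [hr j k h]
    exact Fin.is_lt _
  · rw [hr i k hi, hr j k hj] at hij
    simpa using (σ k).injective (Fin.ext hij)
  · have hmem : e ((σ k).symm ⟨i, hi⟩) = some k :=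
      (mem_filter.1 ((σ k).symm ⟨i, hi⟩).2).2
    refine ⟨(σ k).symm ⟨i, hi⟩, hmem, ?_⟩
    rw [hr _ k hmem]
    simp

variable [DecidableEq ι]

lemma pieceCount_update_some {e : ι → Option κ} {j : ι} (hj : e j = none) (k k' : κ) :
    pieceCount (Function.update e j (some k)) k' =
      pieceCount e k' + if k' = k then 1 else 0 := by
  unfold pieceCount
  split_ifs with h
  · subst h
    have : univ.filter (fun i => Function.update e j (some k') i = some k') =
        insert j (univ.filter fun i => e i = some k') := by
      ext i
      by_cases hi : i = j <;> simp [Function.update_apply, hi]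
    rw [this, card_insert_of_notMem (by simp [hj])]
  · congr 1
    ext i
    by_cases hi : i = j
    · subst hi
      simp [hj, Ne.symm h]
    · simp [Function.update_apply, hi]

lemma pieceCount_update_none {e : ι → Option κ} {j : ι} {k : κ} (hj : e j = some k) (k' : κ) :
    pieceCount e k' =
      pieceCount (Function.update e j none) k' + if k' = k then 1 else 0 := by
  rw [← pieceCount_update_some (j := j) (by simp)]
  simp [← hj]

variable [Fintype κ]

/-- The total value of the edge remainders that `g` assigns to share `j`. -/
def bundleValue (v : κ → ℝ) (q : ℝ) (e : ι → Option κ) (g : κ → ι) (j : ι) : ℝ :=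
  ∑ k with g k = j, remainder v q e k

/-- Edges of values `v` admit the cuts described by `e`, and all bundles are worth at least `q`. -/
def Feasible (v : κ → ℝ) (q : ℝ) (e : ι → Option κ) (g : κ → ι) : Prop :=
  (∀ k, 0 ≤ remainder v q e k) ∧ ∀ j, e j = none → q ≤ bundleValue v q e g j

lemma Feasible.le_sum [Nonempty ι] {v : κ → ℝ} (hv : ∀ k, 0 ≤ v k) {q : ℝ} {e : ι → Option κ}
    {g : κ → ι} (h : Feasible v q e g) : q ≤ ∑ k, v k := by
  rcases le_or_gt q 0 with hq | hq
  · exact hq.trans (sum_nonneg fun k _ => hv k)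
  obtain ⟨j⟩ := ‹Nonempty ι›
  rcases hj : e j with _ | k
  · calc q ≤ bundleValue v q e g j := h.2 j hj
      _ ≤ ∑ k with g k = j, v k := sum_le_sum fun k _ => by
        unfold remainder
        have : 0 ≤ (pieceCount e k : ℝ) * q := by positivity
        linarith
      _ ≤ ∑ k, v k := sum_le_sum_of_subset_of_nonneg (filter_subset _ _) fun k _ _ => hv k
  · have h1 : 1 ≤ pieceCount e k := card_pos.2 ⟨j, by simp [hj]⟩
    have h2 : (1 : ℝ) ≤ pieceCount e k := by exact_mod_cast h1
    have h3 := h.1 k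
    unfold remainder at h3
    have h4 : v k ≤ ∑ k, v k := single_le_sum (fun k _ => hv k) (mem_univ k)
    nlinarith

lemma continuous_bundleValue (v : κ → ℝ) (e : ι → Option κ) (g : κ → ι) (j : ι) :
    Continuous fun q => bundleValue v q e g j :=
  continuous_finsetSum _ fun k _ => continuous_remainder v e k

lemma isClosed_feasible (v : κ → ℝ) (e : ι → Option κ) (g : κ → ι) :
    IsClosed {q | Feasible v q e g} := by
  simp only [Feasible, Set.ofPred_and, Set.ofPred_forall]
  exact (isClosed_iInter fun k => isClosed_le continuous_const (continuous_remainder v e k)).inter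
    (isClosed_iInter fun j => isClosed_iInter fun _ =>
      isClosed_le continuous_id (continuous_bundleValue v e g j))

lemma exists_greatest_feasible [Nonempty ι] {v : κ → ℝ} (hv : ∀ k, 0 ≤ v k)
    (hpos : 0 < ∑ k, v k) :
    ∃ q, 0 < q ∧ (∃ (e : ι → Option κ) (g : κ → ι), Feasible v q e g) ∧
      ∀ q' (e : ι → Option κ) (g : κ → ι), Feasible v q' e g → q' ≤ q := by
  set S : Set ℝ := ⋃ x : (ι → Option κ) × (κ → ι), {q | Feasible v q x.1 x.2} with hS
  have hclosed : IsClosed S := isClosed_iUnion_of_finite fun x => isClosed_feasible v x.1 x.2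
  have hbdd : BddAbove S := by
    refine ⟨∑ k, v k, fun q hq => ?_⟩
    obtain ⟨x, hx⟩ := Set.mem_iUnion.1 hq
    exact Feasible.le_sum hv hx
  obtain ⟨k, -, hk⟩ := exists_lt_of_sum_lt (by simpa using hpos : ∑ k : κ, (0 : ℝ) < ∑ k, v k)
  have hcard : (0 : ℝ) < Fintype.card ι := by exact_mod_cast Fintype.card_pos
  have hmem : v k / Fintype.card ι ∈ S := by
    refine Set.mem_iUnion.2 ⟨(fun _ => some k, fun _ => Classical.arbitrary ι), fun k' => ?_, ?_⟩
    · unfold remainder pieceCount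
      by_cases h : k = k'
      · subst h
        simp only [filter_true, card_univ]
        rw [mul_div_cancel₀ _ hcard.ne', sub_self]
      · simp [h, hv k']
    · simp
  refine ⟨sSup S, (div_pos hk hcard).trans_le (le_csSup hbdd hmem), ?_, fun q' e g h =>
    le_csSup hbdd (Set.mem_iUnion.2 ⟨(e, g), h⟩)⟩
  obtain ⟨x, hx⟩ := Set.mem_iUnion.1 (hclosed.csSup_mem ⟨_, hmem⟩ hbdd)
  exact ⟨x.1, x.2, hx⟩

lemma exists_bundleValue_le_of_greatest {v : κ → ℝ} (hv : ∀ k, 0 ≤ v k) {q : ℝ}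
    (hmax : ∀ q' (e : ι → Option κ) (g : κ → ι), Feasible v q' e g → q' ≤ q)
    {e : ι → Option κ} {g : κ → ι}
    (hstrict : ∀ k, pieceCount e k ≠ 0 → 0 < remainder v q e k) :
    ∃ j, e j = none ∧ bundleValue v q e g j ≤ q := by
  by_contra! hcon
  have h1 : ∀ᶠ q' in 𝓝 q, ∀ k, 0 ≤ remainder v q' e k := by
    refine eventually_all.2 fun k => ?_
    by_cases h0 : pieceCount e k = 0
    · simp [remainder, h0, hv k]
    · exact ((continuous_remainder v e k).continuousAt.eventually
        (eventually_gt_nhds (hstrict k h0))).mono fun _ => le_of_lt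
  have h2 : ∀ᶠ q' in 𝓝 q, ∀ j, e j = none → q' ≤ bundleValue v q' e g j := by
    refine eventually_all.2 fun j => ?_
    by_cases hj : e j = none
    · exact (continuous_id.continuousAt.eventually_lt
        (continuous_bundleValue v e g j).continuousAt (hcon j hj)).mono fun _ h _ => le_of_lt h
    · simp [hj]
  obtain ⟨q', hq', hlt⟩ := (((h1.and h2).filter_mono nhdsWithin_le_nhds).and
    (self_mem_nhdsWithin : Set.Ioi q ∈ 𝓝[>] q)).exists
  exact absurd (hmax q' e g hq') (not_le.2 hlt)

/-- A feasible configuration can be changed so that no edge is used up completely by pieces. -/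
lemma Feasible.exists_strict {v : κ → ℝ} {q : ℝ} (hq : 0 < q) {e : ι → Option κ} {g : κ → ι}
    (h : Feasible v q e g) :
    ∃ (e' : ι → Option κ) (g' : κ → ι), Feasible v q e' g' ∧
      ∀ k, pieceCount e' k ≠ 0 → 0 < remainder v q e' k := by
  induction hN : (∑ k, pieceCount e k) using Nat.strong_induction_on generalizing e g with
  | _ N ih =>
  by_cases hs : ∀ k, pieceCount e k ≠ 0 → 0 < remainder v q e k
  · exact ⟨e, g, h, hs⟩
  push Not at hs
  obtain ⟨k, hk0, hk⟩ := hs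
  have hk : remainder v q e k = 0 := le_antisymm hk (h.1 k)
  obtain ⟨j, hj⟩ := card_pos.1 (Nat.pos_of_ne_zero hk0)
  have hj : e j = some k := by simpa using hj
  have hcount := pieceCount_update_none hj
  set e' := Function.update e j none with he'
  set g' := Function.update g k j with hg'
  have hrem : ∀ k', remainder v q e' k' = remainder v q e k' + if k' = k then q else 0 := by
    intro k'
    unfold remainder
    rw [hcount k']
    split_ifs <;> push_cast <;> ring
  have hrem0 : ∀ k', 0 ≤ remainder v q e' k' := by
    intro k'
    rw [hrem]
    have := h.1 k'
    split_ifs <;> linarith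
  refine ih _ ?_ (e := e') (g := g') ⟨hrem0, fun j' hj' => ?_⟩ rfl
  · rw [← hN]
    refine sum_lt_sum (fun k' _ => ?_) ⟨k, mem_univ k, ?_⟩
    · rw [hcount k']
      exact Nat.le_add_right _ _
    · rw [hcount k]
      simp
  · by_cases hjj : j' = j
    · subst hjj
      have hle : remainder v q e' k ≤ bundleValue v q e' g' j' :=
        single_le_sum (f := fun k => remainder v q e' k) (fun k' _ => hrem0 k') (by simp [hg'])
      rwa [hrem, hk, if_pos rfl, zero_add] at hle
    · have hb := h.2 j' (by simpa [he', hjj] using hj')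
      refine hb.trans ?_
      unfold bundleValue
      rw [sum_filter, sum_filter]
      refine sum_le_sum fun k' _ => ?_
      by_cases hkk : k' = k
      · subst hkk
        simp [hg', hk, Ne.symm hjj]
      · simp [hg', hkk, hrem]

/-- For the greatest feasible value, all remainders can be made at most `q`. -/
lemma Feasible.exists_remainder_le {v : κ → ℝ} (hv : ∀ k, 0 ≤ v k) {q : ℝ}
    (hmax : ∀ q' (e : ι → Option κ) (g : κ → ι), Feasible v q' e g → q' ≤ q)
    {e : ι → Option κ} {g : κ → ι} (h : Feasible v q e g)
    (hstrict : ∀ k, pieceCount e k ≠ 0 → 0 < remainder v q e k) :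
    ∃ (e' : ι → Option κ) (g' : κ → ι), Feasible v q e' g' ∧
      (∀ k, pieceCount e' k ≠ 0 → 0 < remainder v q e' k) ∧
      ∀ k, remainder v q e' k ≤ q := by
  induction hN : #{j | e j = none} using Nat.strong_induction_on generalizing e g with
  | _ N ih =>
  by_cases hs : ∀ k, remainder v q e k ≤ q
  · exact ⟨e, g, h, hstrict, hs⟩
  push Not at hs
  obtain ⟨k, hk⟩ := hs
  obtain ⟨j, hj, hgk⟩ : ∃ j, e j = none ∧ (e (g k) = none → g k = j) := by
    by_cases hg : e (g k) = none
    · exact ⟨g k, hg, fun _ => rfl⟩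
    · obtain ⟨j, hj, -⟩ := exists_bundleValue_le_of_greatest (g := g) hv hmax hstrict
      exact ⟨j, hj, fun h => absurd h hg⟩
  have hcount := pieceCount_update_some hj k
  set e' := Function.update e j (some k) with he'
  have hrem : ∀ k', remainder v q e' k' = remainder v q e k' - if k' = k then q else 0 := by
    intro k'
    unfold remainder
    rw [hcount k']
    split_ifs <;> push_cast <;> ring
  refine ih _ ?_ (e := e') (g := g) ⟨fun k' => ?_, fun j' hj' => ?_⟩ (fun k' hk' => ?_) rfl
  · rw [← hN]
    refine card_lt_card ⟨fun i => ?_, fun hsub => ?_⟩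
    · by_cases hi : i = j <;> simp [he', hi]
    · simpa [he'] using hsub (by simpa using hj : j ∈ ({i | e i = none} : Finset ι))
  · rw [hrem]
    split_ifs with hkk
    · subst hkk
      linarith
    · simpa using h.1 k'
  · have hjj : j' ≠ j := by
      rintro rfl
      simp [he'] at hj'
    have hj'' : e j' = none := by simpa [he', hjj] using hj'
    refine (h.2 j' hj'').trans_eq (sum_congr rfl fun k' hk' => ?_)
    have hk' : g k' = j' := by simpa using hk'
    have hkk : k' ≠ k := by
      rintro rfl
      exact hjj (hk'.symm.trans (hgk (hk' ▸ hj'')))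
    simp [hrem, hkk]
  · rw [hrem]
    split_ifs with hkk
    · subst hkk
      linarith
    · rw [hcount, if_neg hkk, add_zero] at hk'
      simpa using hstrict k' hk'

/-- Moving a single remainder from a bundle above `2q` to one of value exactly `q` reduces the
number of bundles of value at most `q`, so all bundles can be brought into `[q, 2q]`. -/
lemma Feasible.exists_bundleValue_le {v : κ → ℝ} (hv : ∀ k, 0 ≤ v k) {q : ℝ} (hq : 0 < q)
    (hmax : ∀ q' (e : ι → Option κ) (g : κ → ι), Feasible v q' e g → q' ≤ q)
    {e : ι → Option κ} {g : κ → ι} (h : Feasible v q e g)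
    (hstrict : ∀ k, pieceCount e k ≠ 0 → 0 < remainder v q e k)
    (hle : ∀ k, remainder v q e k ≤ q) (hg : ∀ k, e (g k) = none) :
    ∃ g' : κ → ι, Feasible v q e g' ∧ (∀ k, e (g' k) = none) ∧
      ∀ j, e j = none → bundleValue v q e g' j ≤ 2 * q := by
  induction hN : #{j | e j = none ∧ bundleValue v q e g j ≤ q} using Nat.strong_induction_on
    generalizing g with
  | _ N ih =>
  by_cases hs : ∀ j, e j = none → bundleValue v q e g j ≤ 2 * q
  · exact ⟨g, h, hg, hs⟩
  push Not at hs
  obtain ⟨b, hb, hbq⟩ := hs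
  obtain ⟨a, ha, haq⟩ := exists_bundleValue_le_of_greatest (g := g) hv hmax hstrict
  have hab : a ≠ b := by
    rintro rfl
    linarith
  obtain ⟨k, hkb, hkpos⟩ : ∃ k ∈ ({k | g k = b} : Finset κ), 0 < remainder v q e k :=
    exists_lt_of_sum_lt (f := fun _ => 0) <| by
      rw [sum_const_zero]
      exact show 0 < bundleValue v q e g b by linarith
  have hkb : g k = b := by simpa using hkb
  set g' := Function.update g k a with hg'
  have hval : ∀ j, bundleValue v q e g' j = bundleValue v q e g j +
      ((if j = a then remainder v q e k else 0) - if j = b then remainder v q e k else 0) := by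
    intro j
    have hsplit : ∀ f : κ → ι, bundleValue v q e f j =
        (if f k = j then remainder v q e k else 0) +
          ∑ k' ∈ univ.erase k, if f k' = j then remainder v q e k' else 0 := fun f => by
      rw [add_sum_erase univ (fun k' => if f k' = j then remainder v q e k' else 0) (mem_univ k)]
      exact sum_filter _ _
    have hsame : (∑ k' ∈ univ.erase k, if g' k' = j then remainder v q e k' else 0) =
        ∑ k' ∈ univ.erase k, if g k' = j then remainder v q e k' else 0 :=
      sum_congr rfl fun k' hk' => by simp [hg', (mem_erase.1 hk').1]
    rw [hsplit g', hsplit g, hsame, hkb]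
    simp only [hg', Function.update_self, eq_comm (a := j)]
    ring
  have hlek := hle k
  refine ih _ ?_ (g := g') ⟨h.1, fun j hj => ?_⟩ (fun k' => ?_) rfl
  · rw [← hN]
    refine card_lt_card ⟨fun j => ?_, fun hsub => ?_⟩
    · simp only [mem_filter, mem_univ, true_and]
      rintro ⟨hj, hjq⟩
      refine ⟨hj, ?_⟩
      rw [hval] at hjq
      by_cases hjb : j = b
      · subst hjb
        simp only [Ne.symm hab, if_true, if_false] at hjq
        linarith
      · simp only [hjb, if_false] at hjq
        split_ifs at hjq <;> linarith
    · have := hsub (by simp [ha, haq] :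
        a ∈ ({j | e j = none ∧ bundleValue v q e g j ≤ q} : Finset ι))
      simp only [mem_filter, mem_univ, true_and, hval, if_true, hab, if_false] at this
      linarith [h.2 a ha]
  · rw [hval]
    have := h.2 j hj
    by_cases hjb : j = b
    · subst hjb
      simp only [Ne.symm hab, if_true, if_false]
      linarith
    · simp only [hjb, if_false]
      split_ifs <;> linarith
  · by_cases hkk : k' = k
    · simp [hg', hkk, ha]
    · simp [hg', hkk, hg k']

/-- Edge values `v` can be divided into pieces of value `q` and bundles of remainders whose
values lie in `[q, 2q]`. -/
lemma exists_balanced_bundles [Nonempty ι] {v : κ → ℝ} (hv : ∀ k, 0 ≤ v k)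
    (hpos : 0 < ∑ k, v k) :
    ∃ (q : ℝ) (e : ι → Option κ) (g : κ → ι), 0 < q ∧ Feasible v q e g ∧
      (∀ k, e (g k) = none) ∧ ∀ j, e j = none → bundleValue v q e g j ≤ 2 * q := by
  obtain ⟨q, hq, ⟨e₀, g₀, h₀⟩, hmax⟩ := exists_greatest_feasible (ι := ι) hv hpos
  obtain ⟨e₁, g₁, h₁, hs₁⟩ := h₀.exists_strict hq
  obtain ⟨e, g, h, hs, hle⟩ := h₁.exists_remainder_le hv hmax hs₁
  obtain ⟨j₀, hj₀, -⟩ := exists_bundleValue_le_of_greatest (g := g) hv hmax hs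
  have hfeas : Feasible v q e (fun k => if e (g k) = none then g k else j₀) := by
    refine ⟨h.1, fun j hj => (h.2 j hj).trans ?_⟩
    refine sum_le_sum_of_subset_of_nonneg (fun k hk => ?_) fun k _ _ => h.1 k
    have hk : g k = j := by simpa using hk
    simp [hk, hj]
  obtain ⟨g', h', hg', hle'⟩ := hfeas.exists_bundleValue_le hv hq hmax hs hle fun k => by
    split_ifs with hk <;> assumption
  exact ⟨q, e, g', hq, h', hg', hle'⟩

end Combinatorics

/-- Cut points on `[0,1]` marking off prescribed values of an atomless measure. -/
lemma exists_cut_points (μ : Measure ℝ) [IsFiniteMeasure μ] [NullSingletonClass μ] :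
    ∃ c : ℝ → ℝ, c 0 = 0 ∧ MonotoneOn c (Set.Icc 0 (μ.real (Set.Icc 0 1))) ∧
      (∀ y ∈ Set.Icc 0 (μ.real (Set.Icc 0 1)), c y ∈ Set.Icc (0 : ℝ) 1) ∧
      (∀ y ∈ Set.Icc 0 (μ.real (Set.Icc 0 1)),
        μ.real (Set.Icc (c y) 1) = μ.real (Set.Icc 0 1) - y) ∧
      ∀ y ∈ Set.Icc 0 (μ.real (Set.Icc 0 1)), ∀ z ∈ Set.Icc 0 (μ.real (Set.Icc 0 1)), y ≤ z →
        μ.real (Set.Icc (c y) (c z)) = z - y := by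
  set F : ℝ → ℝ := fun s => ∫ _ in (0 : ℝ)..s, (1 : ℝ) ∂μ with hF
  have hint : ∀ a b, IntervalIntegrable (fun _ => (1 : ℝ)) μ a b := fun a b =>
    intervalIntegrable_const
  have hcont : Continuous F := intervalIntegral.continuous_primitive hint 0
  have hIcc : ∀ {a b}, a ≤ b → μ.real (Set.Icc a b) = F b - F a := by
    intro a b hab
    rw [hF, intervalIntegral.integral_interval_sub_left (hint _ _) (hint _ _),
      intervalIntegral.integral_const']
    simp [hab, measureReal_congr Ioc_ae_eq_Icc]
  have hF0 : F 0 = 0 := by simp [hF]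
  have hF1 : F 1 = μ.real (Set.Icc 0 1) := by rw [hIcc zero_le_one, hF0, sub_zero]
  have hmono : Monotone F := fun a b hab => by
    have := hIcc hab
    linarith [measureReal_nonneg (μ := μ) (s := Set.Icc a b)]
  have hex : ∀ y, ∃ s, y ∈ Set.Icc 0 (μ.real (Set.Icc 0 1)) →
      s ∈ Set.Icc (0 : ℝ) 1 ∧ F s = y ∧ (y = 0 → s = 0) := by
    intro y
    by_cases hy : y ∈ Set.Icc 0 (μ.real (Set.Icc 0 1))
    · by_cases hy0 : y = 0
      · exact ⟨0, fun _ => ⟨by simp, by simp [hF0, hy0], fun _ => rfl⟩⟩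
      · obtain ⟨s, hs, hsy⟩ := intermediate_value_Icc (zero_le_one' ℝ) hcont.continuousOn
          (by rwa [hF0, hF1] : y ∈ Set.Icc (F 0) (F 1))
        exact ⟨s, fun _ => ⟨hs, hsy, fun h => absurd h hy0⟩⟩
    · exact ⟨0, fun h => absurd h hy⟩
  choose c hc using hex
  have hcmono : MonotoneOn c (Set.Icc 0 (μ.real (Set.Icc 0 1))) := by
    intro y hy z hz hyz
    by_contra! hlt
    have hzy := hmono hlt.le
    rw [(hc y hy).2.1, (hc z hz).2.1] at hzy
    exact hlt.ne (by rw [le_antisymm hzy hyz])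
  refine ⟨c, (hc 0 ⟨le_rfl, measureReal_nonneg⟩).2.2 rfl, hcmono, fun y hy => (hc y hy).1,
    fun y hy => ?_, fun y hy z hz hyz => ?_⟩
  · rw [hIcc (hc y hy).1.2, (hc y hy).2.1, hF1]
  · rw [hIcc (hcmono hy hz hyz), (hc y hy).2.1, (hc z hz).2.1]

lemma Set.finite_of_forall_snd_eq {α β : Type*} [Finite α] {s : Set (α × β)} (h : α → β)
    (hs : ∀ x ∈ s, x.2 = h x.1) : s.Finite :=
  (Set.finite_range fun a => (a, h a)).subset fun x hx => ⟨x.1, Prod.ext rfl (hs x hx).symm⟩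

/-- For any `n ≥ 2` agents with a common nonatomic normalized valuation over a star cake
with `m ≥ 1` edges, there exists a connected allocation of the star cake that is 2-EF. -/
theorem star_identical_two_EF (n m : ℕ) (hn : 2 ≤ n) (hm : 1 ≤ m)
    (μ : Fin m → Measure ℝ)
    (hfin : ∀ k, IsFiniteMeasure (μ k))
    (hnonatomic : ∀ k (x : ℝ), μ k {x} = 0)
    (hnorm : ∑ k, (μ k (Set.Icc (0 : ℝ) 1)).toReal = 1) :
    ∃ A : Fin n → Set (Fin m × ℝ),
      (∀ i, StarConnected m (A i)) ∧
      (∀ i j, i ≠ j → (A i ∩ A j).Finite) ∧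
      (⋃ i, A i) = (Set.univ : Set (Fin m)) ×ˢ Set.Icc (0 : ℝ) 1 ∧
      (∀ i j, ∑ k, (μ k {t ∈ Set.Icc (0 : ℝ) 1 | (k, t) ∈ A j}).toReal ≤
        2 * ∑ k, (μ k {t ∈ Set.Icc (0 : ℝ) 1 | (k, t) ∈ A i}).toReal) := by
  have := hfin
  have : ∀ k, NullSingletonClass (μ k) := fun k => ⟨hnonatomic k⟩
  have : Nonempty (Fin n) := ⟨⟨0, by omega⟩⟩
  obtain ⟨q, e, g, hq, hfeas, hg, hle⟩ := exists_balanced_bundles (ι := Fin n)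
    (v := fun k => (μ k).real (Set.Icc 0 1)) (fun k => measureReal_nonneg)
    (by simp only [Measure.real, hnorm, zero_lt_one])
  obtain ⟨r, hrlt, hrinj, hrsurj⟩ := exists_piece_numbering e
  choose c hc0 hcmono hcmem hcend hcsub using fun k => exists_cut_points (μ k)
  have hiq : ∀ k (i : ℕ), i ≤ pieceCount e k →
      (i : ℝ) * q ∈ Set.Icc 0 ((μ k).real (Set.Icc 0 1)) := by
    intro k i hi
    have hrem := hfeas.1 k
    unfold remainder at hrem
    have : (i : ℝ) * q ≤ pieceCount e k * q := by gcongr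
    exact ⟨by positivity, by linarith⟩
  let t : Fin m → ℕ → ℝ := fun k i => c k (i * q)
  have ht : ∀ k i, i ≤ pieceCount e k → t k i ∈ Set.Icc (0 : ℝ) 1 := fun k i hi =>
    hcmem k _ (hiq k i hi)
  have htmono : ∀ k i j, i ≤ j → j ≤ pieceCount e k → t k i ≤ t k j := fun k i j hij hj =>
    hcmono k (hiq k i (hij.trans hj)) (hiq k j hj) (by gcongr)
  let b : Fin n → Fin m → ℝ := fun j k => if g k = j then t k (pieceCount e k) else 1
  have hb : ∀ j k, b j k ∈ Set.Icc (0 : ℝ) 1 := by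
    intro j k
    simp only [b]
    split_ifs
    · exact ht k _ le_rfl
    · simp
  have hbt : ∀ j k, t k (pieceCount e k) ≤ b j k := by
    intro j k
    simp only [b]
    split_ifs
    · exact le_rfl
    · exact (ht k _ le_rfl).2
  let A : Fin n → Set (Fin m × ℝ) := fun j => match e j with
    | some k => ({k} : Set (Fin m)) ×ˢ Set.Icc (t k (r j)) (t k (r j + 1))
    | none => ⋃ k : Fin m, ({k} : Set (Fin m)) ×ˢ Set.Icc (b j k) 1
  have hAsome : ∀ j k, e j = some k →
      A j = ({k} : Set (Fin m)) ×ˢ Set.Icc (t k (r j)) (t k (r j + 1)) := by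
    intro j k h
    simp only [A, h]
  have hAnone : ∀ j, e j = none →
      A j = ⋃ k : Fin m, ({k} : Set (Fin m)) ×ˢ Set.Icc (b j k) 1 := by
    intro j h
    simp only [A, h]
  have hmemsome : ∀ j k, e j = some k → ∀ x : Fin m × ℝ,
      x ∈ A j ↔ x.1 = k ∧ x.2 ∈ Set.Icc (t k (r j)) (t k (r j + 1)) := by
    intro j k h x
    rw [hAsome j k h, Set.mem_prod, Set.mem_singleton_iff]
  have hmemnone : ∀ j, e j = none → ∀ x : Fin m × ℝ, x ∈ A j ↔ x.2 ∈ Set.Icc (b j x.1) 1 := by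
    intro j h x
    simp only [hAnone j h, Set.mem_iUnion, Set.mem_prod, Set.mem_singleton_iff, exists_eq_left']
  have hmixed : ∀ i j k, e i = some k → e j = none → (A i ∩ A j).Finite := by
    intro i j k hi hj
    refine Set.finite_of_forall_snd_eq (b j) fun x hx => ?_
    obtain ⟨hxk, hxi⟩ := (hmemsome i k hi x).1 hx.1
    have hxj := (hmemnone j hj x).1 hx.2
    rw [hxk] at hxj ⊢
    exact le_antisymm (hxi.2.trans ((htmono k _ _ (hrlt i k hi) le_rfl).trans (hbt j k))) hxj.1
  have hpieces : ∀ i j k k', e i = some k → e j = some k' → r i < r j → (A i ∩ A j).Finite := by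
    intro i j k k' hi hj hij
    refine Set.finite_of_forall_snd_eq (fun _ => t k (r i + 1)) fun x hx => ?_
    obtain ⟨hxk, hxi⟩ := (hmemsome i k hi x).1 hx.1
    obtain ⟨hxk', hxj⟩ := (hmemsome j k' hj x).1 hx.2
    obtain rfl : k = k' := hxk.symm.trans hxk'
    exact le_antisymm hxi.2 ((htmono k _ _ hij (hrlt j k hj).le).trans hxj.1)
  have hvalue : ∀ j, q ≤ ∑ k, (μ k {s ∈ Set.Icc (0 : ℝ) 1 | (k, s) ∈ A j}).toReal ∧
      ∑ k, (μ k {s ∈ Set.Icc (0 : ℝ) 1 | (k, s) ∈ A j}).toReal ≤ 2 * q := by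
    intro j
    rcases hj : e j with _ | k
    · have hset : ∀ k, {s ∈ Set.Icc (0 : ℝ) 1 | (k, s) ∈ A j} = Set.Icc (b j k) 1 := by
        intro k
        ext s
        simp only [Set.mem_ofPred_eq, hmemnone j hj, and_iff_right_iff_imp]
        exact fun hs => ⟨(hb j k).1.trans hs.1, hs.2⟩
      have hsum : ∑ k, (μ k {s ∈ Set.Icc (0 : ℝ) 1 | (k, s) ∈ A j}).toReal =
          bundleValue (fun k => (μ k).real (Set.Icc 0 1)) q e g j := by
        rw [bundleValue, Finset.sum_filter]
        refine Finset.sum_congr rfl fun k _ => ?_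
        rw [hset k]
        simp only [b]
        split_ifs
        · exact hcend k _ (hiq k _ le_rfl)
        · simp
      rw [hsum]
      exact ⟨hfeas.2 j hj, hle j hj⟩
    · have hr := hrlt j k hj
      have hset : {s ∈ Set.Icc (0 : ℝ) 1 | (k, s) ∈ A j} =
          Set.Icc (t k (r j)) (t k (r j + 1)) := by
        ext s
        simp only [Set.mem_ofPred_eq, hmemsome j k hj, true_and, and_iff_right_iff_imp]
        exact fun hs => ⟨(ht k _ hr.le).1.trans hs.1, hs.2.trans (ht k _ hr).2⟩
      have hsum : ∑ k, (μ k {s ∈ Set.Icc (0 : ℝ) 1 | (k, s) ∈ A j}).toReal = q := by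
        rw [Finset.sum_eq_single_of_mem k (Finset.mem_univ k) fun k' _ hk' => by
          simp [hmemsome j k hj, hk'], hset]
        refine (hcsub k _ (hiq k _ hr.le) _ (hiq k _ hr) ?_).trans ?_
        · gcongr
          simp
        · push_cast
          ring
      rw [hsum]
      exact ⟨le_rfl, by linarith⟩
  refine ⟨A, fun j => ?_, fun i j hij => ?_, ?_, fun i j => ?_⟩
  · rcases hj : e j with _ | k
    · exact Or.inr ⟨b j, hb j, hAnone j hj⟩
    · have hr := hrlt j k hj
      exact Or.inl ⟨k, _, _, (ht k _ hr.le).1, htmono k _ _ (Nat.le_succ _) hr, (ht k _ hr).2,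
        hAsome j k hj⟩
  · rcases hi : e i with _ | k <;> rcases hj : e j with _ | k'
    · refine Set.finite_of_forall_snd_eq (fun _ => 1) fun x hx => ?_
      have hxi := (hmemnone i hi x).1 hx.1
      have hxj := (hmemnone j hj x).1 hx.2
      refine le_antisymm hxi.2 ?_
      by_cases hgi : g x.1 = i
      · simpa [b, hgi, hij] using hxj.1
      · simpa [b, hgi] using hxi.1
    · rw [Set.inter_comm]
      exact hmixed j i k' hj hi
    · exact hmixed i j k hi hj
    · rcases lt_trichotomy (r i) (r j) with h | h | h
      · exact hpieces i j k k' hi hj h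
      · have hkk : k ≠ k' := by
          rintro rfl
          exact hij (hrinj i j k hi hj h)
        refine Set.Finite.subset Set.finite_empty fun x hx => hkk ?_
        exact ((hmemsome i k hi x).1 hx.1).1.symm.trans ((hmemsome j k' hj x).1 hx.2).1
      · rw [Set.inter_comm]
        exact hpieces j i k' k hj hi h
  · ext ⟨k, s⟩
    simp only [Set.mem_iUnion, Set.mem_prod, Set.mem_univ, true_and]
    constructor
    · rintro ⟨j, hjs⟩
      rcases hj : e j with _ | k'
      · have hs := (hmemnone j hj _).1 hjs
        exact ⟨(hb j k).1.trans hs.1, hs.2⟩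
      · obtain ⟨rfl, hs⟩ := (hmemsome j k' hj _).1 hjs
        have hr := hrlt j _ hj
        exact ⟨(ht _ _ hr.le).1.trans hs.1, hs.2.trans (ht _ _ hr).2⟩
    · intro hs
      by_cases hlast : t k (pieceCount e k) ≤ s
      · refine ⟨g k, (hmemnone _ (hg k) _).2 ⟨?_, hs.2⟩⟩
        simpa [b] using hlast
      · have hex : ∃ i, s < t k i := ⟨_, not_le.1 hlast⟩
        have hspec := Nat.find_spec hex
        have hfind : Nat.find hex ≤ pieceCount e k := Nat.find_min' hex (not_le.1 hlast)
        obtain ⟨i, hi⟩ : ∃ i, Nat.find hex = i + 1 := by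
          refine Nat.exists_eq_succ_of_ne_zero fun h0 => ?_
          rw [h0] at hspec
          simp only [t, Nat.cast_zero, zero_mul, hc0] at hspec
          exact absurd hs.1 (not_le.2 hspec)
        have hlow : t k i ≤ s := not_lt.1 (Nat.find_min hex (by omega))
        rw [hi] at hspec hfind
        obtain ⟨j, hj, rfl⟩ := hrsurj k i hfind
        exact ⟨j, (hmemsome j k hj _).2 ⟨rfl, hlow, hspec.le⟩⟩
  · linarith [(hvalue i).1, (hvalue j).2]
end

section
/- Let n ≥ 2 and 1 ≤ k ≤ n be integers, let ι be a finite set, and let f : ι → ℝ satisfy 0 ≤ f(i) < 1/n for every i ∈ ι and Σ_{i ∈ ι} f(i) = k/n. Then there exists a partition of ι into k pairwise disjoint sets B_1, …, B_k with B_1 ∪ ⋯ ∪ B_k = ι such that, writing s_j = Σ_{i ∈ B_j} f(i), one has s_j ≤ 2/n for every j and 2·s_j ≥ s_{j'} for all j, j'. -/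
open Finset in
/-- Every finite family of reals can be distributed over finitely many groups so that moving an
element of positive value to another group cannot decrease the sum of squares of the group
values: the value of its group exceeds that of any other group by at most its own value. -/
theorem exists_locally_balanced_assignment {ι κ : Type*} [Fintype ι] [DecidableEq ι]
    [Fintype κ] [DecidableEq κ] [Nonempty κ] (f : ι → ℝ) :
    ∃ g : ι → κ, ∀ i b, 0 < f i →
      ∑ l with g l = g i, f l ≤ ∑ l with g l = b, f l + f i := by
  obtain ⟨g, hg⟩ := Finite.exists_min fun g : ι → κ ↦ ∑ j, (∑ l with g l = j, f l) ^ 2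
  refine ⟨g, fun i b hi ↦ ?_⟩
  by_cases hb : b = g i
  · subst hb
    linarith
  by_contra! hlt
  have move (j : κ) : ∑ l with Function.update g i b l = j, f l =
      ∑ l with g l = j, f l + (if j = b then f i else 0) - (if j = g i then f i else 0) := by
    simp only [sum_filter]
    rw [← add_sum_erase univ (fun l ↦ if Function.update g i b l = j then f l else 0)
      (mem_univ i), ← add_sum_erase univ (fun l ↦ if g l = j then f l else 0) (mem_univ i)]
    have rest : ∑ l ∈ univ.erase i, (if Function.update g i b l = j then f l else 0) =
        ∑ l ∈ univ.erase i, (if g l = j then f l else 0) :=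
      sum_congr rfl fun l hl ↦ by rw [Function.update_of_ne (ne_of_mem_erase hl)]
    rw [rest, Function.update_self]
    simp only [eq_comm (a := j)]
    ring
  have square (j : κ) : (∑ l with Function.update g i b l = j, f l) ^ 2 =
      (∑ l with g l = j, f l) ^ 2
        + (if j = b then 2 * f i * ∑ l with g l = b, f l + f i ^ 2 else 0)
        + (if j = g i then f i ^ 2 - 2 * f i * ∑ l with g l = g i, f l else 0) := by
    rw [move]
    by_cases h₁ : j = b
    · subst h₁
      simp only [if_true, if_neg hb]
      ring
    · by_cases h₂ : j = g i
      · subst h₂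
        simp only [if_true, if_neg h₁]
        ring
      · simp [h₁, h₂]
  have hmin := hg (Function.update g i b)
  simp only [square, sum_add_distrib, sum_ite_eq', mem_univ, if_true] at hmin
  nlinarith [mul_pos hi (sub_pos.2 hlt)]

/-- Bag-filling for star graphs: if each stub has value less than `1/n` and the stubs have
total value `k/n`, then the stubs can be partitioned into `k` groups so that every group is
worth at most `2/n` and every group is worth at least half of every other group. -/
theorem bag_filling (n k : ℕ) (hn : 2 ≤ n) (hk1 : 1 ≤ k) (hkn : k ≤ n)
    {ι : Type*} [Fintype ι] [DecidableEq ι] (f : ι → ℝ)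
    (hf0 : ∀ i, 0 ≤ f i) (hf1 : ∀ i, f i < 1 / (n : ℝ))
    (hsum : ∑ i, f i = (k : ℝ) / n) :
    ∃ B : Fin k → Finset ι,
      (∀ j j', j ≠ j' → Disjoint (B j) (B j')) ∧
      Finset.univ.biUnion B = Finset.univ ∧
      (∀ j, ∑ i ∈ B j, f i ≤ 2 / (n : ℝ)) ∧
      (∀ j j', ∑ i ∈ B j', f i ≤ 2 * ∑ i ∈ B j, f i) := by
  have : NeZero k := ⟨by omega⟩
  have hn0 : (0 : ℝ) < 1 / n := by positivity
  obtain ⟨g, hg⟩ := exists_locally_balanced_assignment (κ := Fin k) f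
  set B : Fin k → Finset ι := fun j ↦ {i | g i = j} with hB
  have hmem {i : ι} {j : Fin k} : i ∈ B j ↔ g i = j := by simp [hB]
  have htotal : ∑ j, ∑ i ∈ B j, f i = ∑ _j : Fin k, (1 : ℝ) / n := by
    rw [Finset.sum_fiberwise, hsum]
    simp [div_eq_mul_inv]
  obtain ⟨jmin, -, hjmin⟩ := Finset.exists_le_of_sum_le Finset.univ_nonempty htotal.le
  obtain ⟨javg, -, hjavg⟩ := Finset.exists_le_of_sum_le Finset.univ_nonempty htotal.ge
  obtain ⟨jmax, hjmax⟩ := Finite.exists_max fun j ↦ ∑ i ∈ B j, f i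
  have hmax : 1 / (n : ℝ) ≤ ∑ i ∈ B jmax, f i := hjavg.trans (hjmax javg)
  have half (j j' : Fin k) : ∑ i ∈ B j', f i ≤ 2 * ∑ i ∈ B j, f i := by
    refine (hjmax j').trans ?_
    by_contra! hlt
    have gap {i : ι} (hi : i ∈ B jmax) (hpos : 0 < f i) :
        ∑ l ∈ B jmax, f l ≤ ∑ l ∈ B j, f l + f i := by
      have := hg i j hpos
      rwa [hmem.1 hi] at this
    obtain ⟨i₀, hi₀, hpos₀⟩ := Finset.exists_lt_of_sum_lt (s := B jmax) (f := fun _ ↦ (0 : ℝ))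
      (g := f) (by rw [Finset.sum_const_zero]; linarith)
    have hsplit := Finset.add_sum_erase (B jmax) f hi₀
    obtain ⟨i₁, hi₁, hpos₁⟩ := Finset.exists_lt_of_sum_lt (s := (B jmax).erase i₀)
      (f := fun _ ↦ (0 : ℝ)) (g := f) (by rw [Finset.sum_const_zero]; linarith [hf1 i₀])
    have hle := Finset.single_le_sum (fun i _ ↦ hf0 i) hi₁
    linarith [gap hi₀ hpos₀, gap (Finset.mem_of_mem_erase hi₁) hpos₁]
  refine ⟨B, fun j j' hne ↦ ?_, ?_, fun j ↦ ?_, half⟩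
  · exact Finset.disjoint_left.2 fun i hi hi' ↦ hne ((hmem.1 hi).symm.trans (hmem.1 hi'))
  · ext i
    simp [hmem]
  · calc ∑ i ∈ B j, f i ≤ 2 * ∑ i ∈ B jmin, f i := half jmin j
      _ ≤ 2 * (1 / n) := by gcongr
      _ = 2 / n := by ring
end

section
/- Let n ≥ 2 be an integer, set ξ = 1/(2n−1), and let a_1, …, a_{n−1} be real numbers such that for each i ∈ {1, …, n−1}, defining β_i = (1/2)·(2·i·ξ − Σ_{j=1}^{i−1} a_j), we have β_i ≤ a_i < 2·β_i. Then for every i ∈ {1, …, n−1}: (i) ξ ≤ a_i < (4 − 2^{2−i})·ξ, and (ii) (2i − 2 + 2^{1−i})·ξ ≤ Σ_{j=1}^{i} a_j < 2·i·ξ. -/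
/-- If each term `a i` with `1 ≤ i ≤ N` lies between half the gap and the gap from the preceding
partial sum to `2 * i * ξ`, then the partial sums satisfy
`(2 m - 2 + 2 ^ (1 - m)) * ξ ≤ ∑ j ∈ Ico 1 (m + 1), a j ≤ 2 * m * ξ` for all `m ≤ N`. -/
theorem sum_Ico_bounds_of_half_gap_le {N : ℕ} {a : ℕ → ℝ} {ξ : ℝ}
    (ha : ∀ i ∈ Finset.Icc 1 N,
      (1 / 2 : ℝ) * (2 * (i : ℝ) * ξ - ∑ j ∈ Finset.Ico 1 i, a j) ≤ a i ∧
      a i < 2 * ((1 / 2 : ℝ) * (2 * (i : ℝ) * ξ - ∑ j ∈ Finset.Ico 1 i, a j)))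
    {m : ℕ} (hm : m ≤ N) :
    (2 * (m : ℝ) - 2 + (2 : ℝ) ^ ((1 : ℝ) - (m : ℝ))) * ξ ≤ ∑ j ∈ Finset.Ico 1 (m + 1), a j ∧
      ∑ j ∈ Finset.Ico 1 (m + 1), a j ≤ 2 * (m : ℝ) * ξ := by
  induction m with
  | zero => simp
  | succ k ih =>
    obtain ⟨hlow, -⟩ := ih (by lia)
    obtain ⟨hge, hlt⟩ := ha (k + 1) (Finset.mem_Icc.2 ⟨by lia, hm⟩)
    have hpow : (2 : ℝ) ^ ((1 : ℝ) - (k : ℝ)) = 2 ^ ((1 : ℝ) - ((k + 1 : ℕ) : ℝ)) * 2 := by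
      rw [← Real.rpow_add_one two_ne_zero]
      congr 1
      push_cast
      ring
    rw [hpow] at hlow
    rw [Finset.sum_Ico_succ_top (by lia : 1 ≤ k + 1)]
    generalize (2 : ℝ) ^ ((1 : ℝ) - ((k + 1 : ℕ) : ℝ)) = p at *
    push_cast at *
    constructor <;> linarith


/-- Inductive invariants of `IterativeDivide` with identical valuations and adaptive
thresholds `β_i = (1/2)·(2·i·ξ − Σ_{j<i} a_j)`, where `ξ = 1/(2n−1)`: if every allocated
share satisfies `β_i ≤ a_i < 2·β_i`, then for each `i ∈ {1, …, n−1}` we have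
`ξ ≤ a_i < (4 − 2^{2−i})·ξ` and `(2i − 2 + 2^{1−i})·ξ ≤ Σ_{j=1}^{i} a_j < 2·i·ξ`. -/
theorem iterativeDivide_invariants (n : ℕ) (hn : 2 ≤ n) (a : ℕ → ℝ)
    (ha : ∀ i ∈ Finset.Icc 1 (n - 1),
      (1 / 2 : ℝ) * (2 * (i : ℝ) * (1 / (2 * (n : ℝ) - 1)) - ∑ j ∈ Finset.Ico 1 i, a j) ≤ a i ∧
      a i < 2 * ((1 / 2 : ℝ) *
        (2 * (i : ℝ) * (1 / (2 * (n : ℝ) - 1)) - ∑ j ∈ Finset.Ico 1 i, a j))) :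
    ∀ i ∈ Finset.Icc 1 (n - 1),
      ((1 / (2 * (n : ℝ) - 1) ≤ a i ∧
        a i < (4 - (2 : ℝ) ^ ((2 : ℝ) - (i : ℝ))) * (1 / (2 * (n : ℝ) - 1))) ∧
      ((2 * (i : ℝ) - 2 + (2 : ℝ) ^ ((1 : ℝ) - (i : ℝ))) * (1 / (2 * (n : ℝ) - 1)) ≤
          ∑ j ∈ Finset.Icc 1 i, a j ∧
        ∑ j ∈ Finset.Icc 1 i, a j < 2 * (i : ℝ) * (1 / (2 * (n : ℝ) - 1)))) := by
  intro i hi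
  obtain ⟨hge, hlt⟩ := ha i hi
  obtain ⟨hi1, hin⟩ := Finset.mem_Icc.1 hi
  obtain ⟨k, rfl⟩ : ∃ k, i = k + 1 := ⟨i - 1, by lia⟩
  obtain ⟨hlow, hup⟩ := sum_Ico_bounds_of_half_gap_le ha (by lia : k ≤ n - 1)
  obtain ⟨hlow', -⟩ := sum_Ico_bounds_of_half_gap_le ha hin
  have hexp : (2 : ℝ) - ((k + 1 : ℕ) : ℝ) = 1 - k := by
    push_cast
    ring
  rw [← Finset.Ico_add_one_right_eq_Icc, hexp]
  refine ⟨⟨?_, ?_⟩, hlow', ?_⟩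
  · push_cast at *
    linarith
  · push_cast at *
    linarith
  · rw [Finset.sum_Ico_succ_top hi1]
    linarith
end

section
/- Let n ≥ 2 be an integer, set ξ = 1/(2n−1), and let a_1, …, a_{n−1} be real numbers such that for each i ∈ {1, …, n−1}, defining β_i = (1/2)·(2·i·ξ − Σ_{j=1}^{i−1} a_j), we have β_i ≤ a_i < 2·β_i; define a_n = 1 − Σ_{j=1}^{n−1} a_j. Then for every i ∈ {1, …, n}: a_i ≥ ξ and a_i ≤ (4 − 2^{3−n})·ξ. Consequently, 4·a_i ≥ a_j for all i, j (the allocation is 4-EF), and a_i ≥ 1/((2 − 1/n)·n) for every i (the allocation is (2 − 1/n)-proportional). -/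
/-- If each `a i` with `1 ≤ i < n` lies between one half of and the whole of the slack
`2·i·ξ − Σ_{j<i} a_j`, then for `1 ≤ i ≤ n` the slack lies between `2ξ` and `(4 − 2^{2−i})·ξ`. -/
theorem slack_mem_Icc {n : ℕ} {a : ℕ → ℝ} {ξ : ℝ}
    (ha : ∀ i ∈ Finset.Ico 1 n,
      (2 * (i : ℝ) * ξ - ∑ j ∈ Finset.Ico 1 i, a j) / 2 ≤ a i ∧
      a i ≤ 2 * (i : ℝ) * ξ - ∑ j ∈ Finset.Ico 1 i, a j)
    {i : ℕ} (hi : 1 ≤ i) (hin : i ≤ n) :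
    2 * (i : ℝ) * ξ - ∑ j ∈ Finset.Ico 1 i, a j ∈
      Set.Icc (2 * ξ) ((4 - 4 * (1 / 2 : ℝ) ^ i) * ξ) := by
  induction i, hi using Nat.le_induction with
  | base => constructor <;> norm_num
  | succ k hk ih =>
    obtain ⟨-, hub⟩ := ih (by omega)
    obtain ⟨hl, hu⟩ := ha k (Finset.mem_Ico.mpr ⟨hk, by omega⟩)
    rw [Finset.sum_Ico_succ_top hk, pow_succ]
    push_cast
    constructor <;> linarith

/-- `IterativeDivide` with identical valuations and adaptive thresholds
`β_i = (1/2)·(2·i·ξ − Σ_{j<i} a_j)`, where `ξ = 1/(2n−1)`, produces an allocation whose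
share values satisfy `ξ ≤ a_i ≤ (4 − 2^{3−n})·ξ` for every `i ∈ {1, …, n}` (where
`a_n = 1 − Σ_{j=1}^{n−1} a_j` is the value of the last share). Consequently the allocation
is 4-EF and `(2 − 1/n)`-proportional. -/
theorem iterativeDivide_four_EF (n : ℕ) (hn : 2 ≤ n) (a : ℕ → ℝ)
    (ha : ∀ i ∈ Finset.Icc 1 (n - 1),
      (1 / 2 : ℝ) * (2 * (i : ℝ) * (1 / (2 * (n : ℝ) - 1)) - ∑ j ∈ Finset.Ico 1 i, a j) ≤ a i ∧
      a i < 2 * ((1 / 2 : ℝ) *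
        (2 * (i : ℝ) * (1 / (2 * (n : ℝ) - 1)) - ∑ j ∈ Finset.Ico 1 i, a j)))
    (han : a n = 1 - ∑ j ∈ Finset.Icc 1 (n - 1), a j) :
    (∀ i ∈ Finset.Icc 1 n,
      1 / (2 * (n : ℝ) - 1) ≤ a i ∧
      a i ≤ (4 - (2 : ℝ) ^ ((3 : ℝ) - (n : ℝ))) * (1 / (2 * (n : ℝ) - 1))) ∧
    (∀ i ∈ Finset.Icc 1 n, ∀ j ∈ Finset.Icc 1 n, a j ≤ 4 * a i) ∧
    (∀ i ∈ Finset.Icc 1 n, 1 / ((2 - 1 / (n : ℝ)) * (n : ℝ)) ≤ a i) := by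
  have hn' : (2 : ℝ) ≤ n := by exact_mod_cast hn
  have hn0 : (0 : ℝ) < 2 * (n : ℝ) - 1 := by linarith
  have hprop : 1 / ((2 - 1 / (n : ℝ)) * (n : ℝ)) = 1 / (2 * (n : ℝ) - 1) := by
    congr 1
    field_simp
  have hpow : (2 : ℝ) ^ ((3 : ℝ) - (n : ℝ)) = 8 * (1 / 2 : ℝ) ^ n := by
    rw [Real.rpow_sub two_pos, Real.rpow_natCast, one_div, inv_pow]
    norm_num [div_eq_mul_inv]
  have hIcc : Finset.Icc 1 (n - 1) = Finset.Ico 1 n := by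
    ext
    simp only [Finset.mem_Icc, Finset.mem_Ico]
    omega
  rw [hIcc] at ha han
  rw [hprop, hpow]
  have hξ : 0 < 1 / (2 * (n : ℝ) - 1) := by positivity
  have hξn : (2 * (n : ℝ) - 1) * (1 / (2 * (n : ℝ) - 1)) = 1 := mul_one_div_cancel hn0.ne'
  generalize 1 / (2 * (n : ℝ) - 1) = ξ at *
  have hslack := fun i => slack_mem_Icc (n := n) (a := a) (ξ := ξ) (i := i) fun k hk =>
    ⟨by linarith [(ha k hk).1], by linarith [(ha k hk).2]⟩
  have hbounds : ∀ i ∈ Finset.Icc 1 n, ξ ≤ a i ∧ a i ≤ (4 - 8 * (1 / 2 : ℝ) ^ n) * ξ := by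
    intro i hi
    obtain ⟨h1, hin⟩ := Finset.mem_Icc.mp hi
    obtain ⟨hlb, hub⟩ := hslack i h1 hin
    rcases hin.lt_or_eq with hlt | rfl
    · obtain ⟨hl, hu⟩ := ha i (Finset.mem_Ico.mpr ⟨h1, hlt⟩)
      have hmono : (1 / 2 : ℝ) ^ n ≤ (1 / 2 : ℝ) ^ (i + 1) :=
        pow_le_pow_of_le_one (by norm_num) (by norm_num) hlt
      rw [pow_succ] at hmono
      have := mul_le_mul_of_nonneg_right hmono hξ.le
      constructor <;> linarith
    · have hquarter : (1 / 2 : ℝ) ^ i ≤ (1 / 2 : ℝ) ^ 2 :=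
        pow_le_pow_of_le_one (by norm_num) (by norm_num) hn
      have := mul_le_mul_of_nonneg_right hquarter hξ.le
      constructor <;> linarith
  refine ⟨hbounds, fun i hi j hj => ?_, fun i hi => (hbounds i hi).1⟩
  have hnonneg : 0 ≤ (1 / 2 : ℝ) ^ n * ξ := by positivity
  linarith [(hbounds i hi).1, (hbounds j hj).2]
end

section
/- Let T be a finite tree (a connected acyclic simple graph) with edge set E and a distinguished root vertex r, let N' be a nonempty finite set, and for each i ∈ N' let w_i : E → ℝ be nonnegative edge weights; for S ⊆ E write w_i(S) = Σ_{e ∈ S} w_i(e). Let β > 0 be a real number, and suppose that w_i(e) < β for every i ∈ N' and every edge e ∈ E, and that w_i(E) ≥ β for some i ∈ N'. Then there exists a set S ⊆ E of edges such that: (a) the subgraph of T consisting of the edges in S together with their endpoints is connected; (b) w_i(S) ≥ β for some i ∈ N'; (c) w_i(S) < 2β for every i ∈ N'; and (d) the subgraph consisting of the edges in E∖S, their endpoints, and the vertex r is connected. -/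
/-- The subgraph consisting of the edges in `S` together with their endpoints and the extra
vertices in `extra` is connected. -/
def EdgesConnectedWith {V : Type*} (S : Set (Sym2 V)) (extra : Set V) : Prop :=
  ((SimpleGraph.fromEdgeSet S).induce ({v | ∃ e ∈ S, v ∈ e} ∪ extra)).Connected

/-- Every endpoint of an edge in `S` can be reached from `v` along edges in `S`. -/
def EdgesReachableFrom {V : Type*} (S : Set (Sym2 V)) (v : V) : Prop :=
  ∀ e ∈ S, ∀ x ∈ e, (SimpleGraph.fromEdgeSet S).Reachable v x

namespace EdgesReachableFrom

variable {V : Type*} {S A B : Set (Sym2 V)} {u v : V}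

lemma reachable_step {x y z : V} (h : (SimpleGraph.fromEdgeSet S).Reachable x y)
    (hyz : s(y, z) ∈ S) : (SimpleGraph.fromEdgeSet S).Reachable x z := by
  by_cases hne : y = z
  · exact hne ▸ h
  · exact h.trans (SimpleGraph.Adj.reachable ((SimpleGraph.fromEdgeSet_adj S).2 ⟨hyz, hne⟩))

lemma union (hA : EdgesReachableFrom A v) (hB : EdgesReachableFrom B v) :
    EdgesReachableFrom (A ∪ B) v := by
  rintro e (he | he) x hx
  · exact (hA e he x hx).mono (SimpleGraph.fromEdgeSet_mono Set.subset_union_left)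
  · exact (hB e he x hx).mono (SimpleGraph.fromEdgeSet_mono Set.subset_union_right)

lemma insert (hS : EdgesReachableFrom S u) (v : V) :
    EdgesReachableFrom (Insert.insert s(v, u) S) v := by
  have hvu : (SimpleGraph.fromEdgeSet (Insert.insert s(v, u) S)).Reachable v u :=
    reachable_step (SimpleGraph.Reachable.refl v) (Set.mem_insert _ _)
  rintro e (rfl | he) x hx
  · rcases Sym2.mem_iff.1 hx with rfl | rfl
    · exact SimpleGraph.Reachable.refl _
    · exact hvu
  · exact hvu.trans ((hS e he x hx).mono (SimpleGraph.fromEdgeSet_mono (Set.subset_insert _ _)))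

lemma exists_mem_edge (hS : EdgesReachableFrom S v) (hne : S.Nonempty) : ∃ u, s(v, u) ∈ S := by
  obtain ⟨e, he⟩ := hne
  induction e using Sym2.ind with
  | _ x y =>
    have h := hS _ he x (Sym2.mem_mk_left x y)
    rw [SimpleGraph.reachable_iff_reflTransGen] at h
    rcases Relation.ReflTransGen.cases_head h with rfl | ⟨u, hu, -⟩
    · exact ⟨y, he⟩
    · exact ⟨u, ((SimpleGraph.fromEdgeSet_adj S).1 hu).1⟩

lemma edgesConnectedWith {extra : Set V} (hS : EdgesReachableFrom S v)
    (hv : v ∈ {x | ∃ e ∈ S, x ∈ e} ∪ extra) (hextra : extra ⊆ {v}) :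
    EdgesConnectedWith S extra := by
  have key : ∀ x, (SimpleGraph.fromEdgeSet S).Reachable v x →
      ∃ hx : x ∈ {x | ∃ e ∈ S, x ∈ e} ∪ extra,
        ((SimpleGraph.fromEdgeSet S).induce ({x | ∃ e ∈ S, x ∈ e} ∪ extra)).Reachable
          ⟨v, hv⟩ ⟨x, hx⟩ := by
    intro x hx
    rw [SimpleGraph.reachable_iff_reflTransGen] at hx
    induction hx with
    | refl => exact ⟨hv, SimpleGraph.Reachable.refl _⟩
    | @tail y z _ hyz ih =>
      obtain ⟨hy, hr⟩ := ih
      refine ⟨Or.inl ⟨s(y, z), ((SimpleGraph.fromEdgeSet_adj S).1 hyz).1,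
        Sym2.mem_mk_right y z⟩, hr.trans (SimpleGraph.Adj.reachable ?_)⟩
      exact hyz
  unfold EdgesConnectedWith
  rw [SimpleGraph.connected_iff_exists_forall_reachable]
  refine ⟨⟨v, hv⟩, ?_⟩
  rintro ⟨x, hx⟩
  have hvx : (SimpleGraph.fromEdgeSet S).Reachable v x := by
    rcases hx with ⟨e, he, hxe⟩ | hx
    · exact hS e he x hxe
    · rw [hextra hx]
  exact (key x hvx).2

/-- An edge set reachable from `v` splits at an edge `s(v, u)` into that edge, a part reachable
from `u`, and a part reachable from `v`. -/
lemma exists_decomposition {S : Finset (Sym2 V)} (hS : EdgesReachableFrom (S : Set (Sym2 V)) v)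
    (he : s(v, u) ∈ S) :
    ∃ A B : Finset (Sym2 V), EdgesReachableFrom (A : Set (Sym2 V)) v ∧
      EdgesReachableFrom (B : Set (Sym2 V)) u ∧ s(v, u) ∉ A ∧ s(v, u) ∉ B ∧ Disjoint A B ∧
      (S : Set (Sym2 V)) = (A : Set (Sym2 V)) ∪ Insert.insert s(v, u) (B : Set (Sym2 V)) := by
  classical
  set R : Set (Sym2 V) := (S : Set (Sym2 V)) \ {s(v, u)} with hR
  let near : Sym2 V → Prop := fun e => ∃ x ∈ e, (SimpleGraph.fromEdgeSet R).Reachable u x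
  have near_of : ∀ e ∈ R, near e → ∀ y ∈ e, (SimpleGraph.fromEdgeSet R).Reachable u y := by
    rintro e heR ⟨x, hx, hux⟩ y hy
    by_cases hxy : x = y
    · exact hxy ▸ hux
    · have : e = s(x, y) := (Sym2.mem_and_mem_iff hxy).1 ⟨hx, hy⟩
      exact reachable_step hux (this ▸ heR)
  have mem_R : ∀ e, e ∈ R ↔ e ∈ S.erase s(v, u) := by
    intro e
    simp [hR, and_comm]
  refine ⟨(S.erase s(v, u)).filter (fun e => ¬ near e), (S.erase s(v, u)).filter near,
    ?_, ?_, by simp, by simp, ?_, ?_⟩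
  · set A := (S.erase s(v, u)).filter (fun e => ¬ near e) with hA
    have key : ∀ x, (SimpleGraph.fromEdgeSet (S : Set (Sym2 V))).Reachable v x →
        (SimpleGraph.fromEdgeSet R).Reachable u x ∨
          (SimpleGraph.fromEdgeSet (A : Set (Sym2 V))).Reachable v x := by
      intro x hx
      rw [SimpleGraph.reachable_iff_reflTransGen] at hx
      induction hx with
      | refl => exact Or.inr (SimpleGraph.Reachable.refl _)
      | @tail y z _ hyz ih =>
        have hmem : s(y, z) ∈ (S : Set (Sym2 V)) := ((SimpleGraph.fromEdgeSet_adj _).1 hyz).1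
        by_cases heq : s(y, z) = s(v, u)
        · have hz : z ∈ s(v, u) := heq ▸ Sym2.mem_mk_right y z
          rcases Sym2.mem_iff.1 hz with rfl | rfl
          · exact Or.inr (SimpleGraph.Reachable.refl _)
          · exact Or.inl (SimpleGraph.Reachable.refl _)
        · have hyzR : s(y, z) ∈ R := ⟨hmem, heq⟩
          by_cases hn : near s(y, z)
          · exact Or.inl (near_of _ hyzR hn z (Sym2.mem_mk_right y z))
          · rcases ih with ih | ih
            · exact absurd ⟨y, Sym2.mem_mk_left y z, ih⟩ hn
            · exact Or.inr (reachable_step ih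
                (Finset.mem_coe.2 (Finset.mem_filter.2 ⟨(mem_R _).1 hyzR, hn⟩)))
    intro e heA x hx
    obtain ⟨heS, hn⟩ := Finset.mem_filter.1 (Finset.mem_coe.1 heA)
    exact (key x (hS e (Finset.mem_of_mem_erase heS) x hx)).resolve_left
      fun h => hn ⟨x, hx, h⟩
  · set B := (S.erase s(v, u)).filter near with hB
    intro e heB x hx
    obtain ⟨heS, hn⟩ := Finset.mem_filter.1 (Finset.mem_coe.1 heB)
    have hux := near_of e ((mem_R e).2 heS) hn x hx
    clear hx
    rw [SimpleGraph.reachable_iff_reflTransGen] at hux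
    induction hux with
    | refl => exact SimpleGraph.Reachable.refl _
    | @tail y z huy hyz ih =>
      rw [← SimpleGraph.reachable_iff_reflTransGen] at huy
      exact reachable_step ih (Finset.mem_coe.2 (Finset.mem_filter.2
        ⟨(mem_R _).1 ((SimpleGraph.fromEdgeSet_adj _).1 hyz).1, y, Sym2.mem_mk_left y z, huy⟩))
  · exact (Finset.disjoint_filter_filter_not _ _ _).symm
  · ext f
    by_cases hf : f = s(v, u)
    · simp [hf, he]
    · by_cases hn : near f <;> simp [hf, hn]

/-- The Divide lemma for an edge set reachable from `v`. -/
lemma exists_divide {N' : Type*} (w : N' → Sym2 V → ℝ) {β : ℝ} (hβ : 0 < β)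
    (S : Finset (Sym2 V)) (v : V) (hS : EdgesReachableFrom (S : Set (Sym2 V)) v)
    (hsmall : ∀ i, ∀ e ∈ S, w i e < β) (hbig : ∃ i, β ≤ ∑ e ∈ S, w i e) :
    ∃ T ⊆ S, (∃ c, (∃ e ∈ T, c ∈ e) ∧ EdgesReachableFrom (T : Set (Sym2 V)) c) ∧
      (∃ i, β ≤ ∑ e ∈ T, w i e) ∧ (∀ i, ∑ e ∈ T, w i e < 2 * β) ∧
      EdgesReachableFrom ((S : Set (Sym2 V)) \ T) v := by
  classical
  induction S using Finset.strongInduction generalizing v with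
  | H S IH =>
    have hne : S.Nonempty := by
      rw [Finset.nonempty_iff_ne_empty]
      rintro rfl
      obtain ⟨i, hi⟩ := hbig
      simp only [Finset.sum_empty] at hi
      linarith
    obtain ⟨u, he⟩ := hS.exists_mem_edge (Finset.coe_nonempty.2 hne)
    obtain ⟨A, B, hA, hB, heA, heB, hAB, hSe⟩ := hS.exists_decomposition he
    have hSeq : S = A ∪ Insert.insert s(v, u) B := by
      rw [← Finset.coe_inj]
      push_cast
      exact hSe
    have hAS : A ⊆ S := hSeq ▸ Finset.subset_union_left
    have heBS : Insert.insert s(v, u) B ⊆ S := hSeq ▸ Finset.subset_union_right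
    have hBS : B ⊆ S := (Finset.subset_insert _ _).trans heBS
    have hAd : Disjoint A (Insert.insert s(v, u) B) := Finset.disjoint_insert_right.2 ⟨heA, hAB⟩
    have hAd' : ∀ f ∈ A, f ≠ s(v, u) ∧ f ∉ B := fun f hf =>
      ⟨fun h => heA (h ▸ hf), Finset.disjoint_left.1 hAB hf⟩
    by_cases hBbig : ∃ i, β ≤ ∑ e ∈ B, w i e
    · obtain ⟨T, hTB, hc, hl, hu, hrest⟩ := IH B ⟨hBS, fun h => heB (h he)⟩ u hB
        (fun i e h => hsmall i e (hBS h)) hBbig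
      refine ⟨T, hTB.trans hBS, hc, hl, hu, ?_⟩
      convert hA.union (hrest.insert v) using 1
      ext f
      have := @hTB f
      have := hAd' f
      simp only [hSe, Set.mem_sdiff, Set.mem_union, Set.mem_insert_iff, Finset.mem_coe]
      grind
    by_cases hAbig : ∃ i, β ≤ ∑ e ∈ A, w i e
    · obtain ⟨T, hTA, hc, hl, hu, hrest⟩ := IH A ⟨hAS, fun h => heA (h he)⟩ v hA
        (fun i e h => hsmall i e (hAS h)) hAbig
      refine ⟨T, hTA.trans hAS, hc, hl, hu, ?_⟩
      convert hrest.union (hB.insert v) using 1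
      ext f
      have := @hTA f
      have := hAd' f
      simp only [hSe, Set.mem_sdiff, Set.mem_union, Set.mem_insert_iff, Finset.mem_coe]
      grind
    push Not at hBbig hAbig
    by_cases hbranch : ∃ i, β ≤ ∑ e ∈ Insert.insert s(v, u) B, w i e
    · refine ⟨Insert.insert s(v, u) B, heBS, ⟨v, ⟨_, Finset.mem_insert_self _ _,
        Sym2.mem_mk_left v u⟩, ?_⟩, hbranch, fun i => ?_, ?_⟩
      · rw [Finset.coe_insert]
        exact hB.insert v
      · rw [Finset.sum_insert heB]
        linarith [hsmall i _ he, hBbig i]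
      · convert hA using 1
        rw [← Finset.coe_sdiff, hSeq, Finset.union_sdiff_cancel_right hAd]
    push Not at hbranch
    refine ⟨S, subset_rfl, ⟨v, ⟨_, he, Sym2.mem_mk_left v u⟩, hS⟩, hbig, fun i => ?_, ?_⟩
    · rw [hSeq, Finset.sum_union hAd]
      linarith [hAbig i, hbranch i]
    · simp [EdgesReachableFrom]

end EdgesReachableFrom

/-- Discrete Divide lemma: in a finite tree whose every single edge is worth less than `β`
to every agent in `N'` and whose full edge set is worth at least `β` to some agent in `N'`,
there is a set `S` of edges forming a connected subgraph, worth at least `β` to some agent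
and less than `2β` to every agent, such that the complementary edges together with their
endpoints and the root `r` also form a connected subgraph. -/
theorem discrete_divide {V : Type*} [Fintype V] [DecidableEq V]
    (G : SimpleGraph V) [DecidableRel G.Adj] (hG : G.IsTree) (r : V)
    {N' : Type*} [Fintype N'] [Nonempty N']
    (w : N' → Sym2 V → ℝ) (hw : ∀ i e, 0 ≤ w i e)
    (β : ℝ) (hβ : 0 < β)
    (hsmall : ∀ i, ∀ e ∈ G.edgeSet, w i e < β)
    (hbig : ∃ i, β ≤ ∑ e ∈ G.edgeFinset, w i e) :
    ∃ S : Finset (Sym2 V), ↑S ⊆ G.edgeSet ∧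
      EdgesConnectedWith (↑S : Set (Sym2 V)) ∅ ∧
      (∃ i, β ≤ ∑ e ∈ S, w i e) ∧
      (∀ i, ∑ e ∈ S, w i e < 2 * β) ∧
      EdgesConnectedWith (G.edgeSet \ ↑S) {r} := by
  have hG' : EdgesReachableFrom (G.edgeFinset : Set (Sym2 V)) r := by
    intro e _ x _
    rw [SimpleGraph.coe_edgeFinset, SimpleGraph.fromEdgeSet_edgeSet]
    exact hG.connected.preconnected r x
  obtain ⟨T, hT, ⟨c, ⟨e, he, hce⟩, hc⟩, hl, hu, hrest⟩ := hG'.exists_divide w hβ _ _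
    (fun i e he => hsmall i e (SimpleGraph.mem_edgeFinset.1 he)) hbig
  rw [SimpleGraph.coe_edgeFinset] at hrest
  exact ⟨T, fun f hf => SimpleGraph.mem_edgeFinset.1 (hT hf),
    hc.edgesConnectedWith (Or.inl ⟨e, he, hce⟩) (Set.empty_subset _), hl, hu,
    hrest.edgesConnectedWith (Or.inr rfl) (Set.Subset.refl {r})⟩
end

section
/- Let T be a finite tree (a connected acyclic simple graph) with m edges and a root vertex r, and suppose every vertex of T is at graph distance at most h from r (T has height at most h). Then there exists an enumeration e_1, …, e_m of the edges of T such that for all 1 ≤ i ≤ j ≤ m, the subgraph of T whose edge set is {e_i, e_{i+1}, …, e_j} and whose vertex set is the set of endpoints of these edges has at most h + 1 connected components. -/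
/-- The number of connected components of the subgraph formed by the edges in `S`
together with their endpoints. -/
noncomputable def edgeComponents {V : Type*} (S : Set (Sym2 V)) : ℕ :=
  Nat.card ((SimpleGraph.fromEdgeSet S).induce {v | ∃ e ∈ S, v ∈ e}).ConnectedComponent

/-- In the lexicographic order, the extensions of a list form an interval starting at it. -/
theorem List.isPrefix_of_not_lt_of_not_lt {α : Type*} [LinearOrder α] :
    ∀ {a b c : List α}, a <+: c → ¬ b < a → ¬ c < b → a <+: b
  | [], _, _, _, _, _ => List.nil_prefix
  | _ :: _, [], _, _, hab, _ => absurd (List.nil_lt_cons _ _) hab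
  | _ :: _, _ :: _, [], hac, _, _ => by simp at hac
  | x :: a, y :: b, z :: c, hac, hab, hbc => by
    obtain ⟨rfl, hac'⟩ := List.cons_prefix_cons.1 hac
    simp only [List.cons_lt_cons_iff, not_or, not_and] at hab hbc
    obtain rfl : x = y := le_antisymm (not_lt.1 hab.1) (not_lt.1 hbc.1)
    exact List.cons_prefix_cons.2
      ⟨rfl, List.isPrefix_of_not_lt_of_not_lt hac' (hab.2 rfl) (hbc.2 rfl)⟩

/-- If every vertex covered by `S` that lies outside the finite set `A` is joined by an edge
of `S` to a vertex of smaller rank, then `S` has at most `A.ncard` components. -/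
theorem edgeComponents_le_ncard {V : Type*} {S : Set (Sym2 V)} {A : Set V} (hA : A.Finite)
    (d : V → ℕ) (hS : ∀ x, (∃ e ∈ S, x ∈ e) → x ∈ A ∨ ∃ y, s(y, x) ∈ S ∧ d y < d x) :
    edgeComponents S ≤ A.ncard := by
  set H := (SimpleGraph.fromEdgeSet S).induce {v | ∃ e ∈ S, v ∈ e} with hH
  have key : ∀ n, ∀ x : {v | ∃ e ∈ S, v ∈ e}, d x = n → ∃ w, H.Reachable w x ∧ (w : V) ∈ A := by
    intro n
    induction n using Nat.strong_induction_on with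
    | _ n ih =>
      rintro ⟨x, hx⟩ hn
      obtain h | ⟨y, hy, hlt⟩ := hS x hx
      · exact ⟨⟨x, hx⟩, SimpleGraph.Reachable.refl _, h⟩
      · obtain ⟨w, hw, hwA⟩ := ih (d y) (hn ▸ hlt) ⟨y, s(y, x), hy, Sym2.mem_mk_left y x⟩ rfl
        refine ⟨w, hw.trans (SimpleGraph.Adj.reachable ?_), hwA⟩
        simp only [hH, SimpleGraph.comap_adj, SimpleGraph.fromEdgeSet_adj]
        exact ⟨hy, fun hyx => hlt.ne (congrArg d hyx)⟩
  have hrep : ∀ C : H.ConnectedComponent, ∃ w, H.connectedComponentMk w = C ∧ (w : V) ∈ A := by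
    intro C
    induction C using SimpleGraph.ConnectedComponent.ind with
    | _ x =>
      obtain ⟨w, hw, hwA⟩ := key _ x rfl
      exact ⟨w, SimpleGraph.ConnectedComponent.sound hw, hwA⟩
  choose g hg hgA using hrep
  have : Finite A := hA
  rw [← Nat.card_coe_set_eq]
  refine Nat.card_le_card_of_injective (fun C => (⟨g C, hgA C⟩ : A)) fun C D hCD => ?_
  rw [← hg C, ← hg D, Subtype.ext (Subtype.mk.inj hCD)]

/-- A vertex other than `r` in a connected graph has a neighbour closer to `r`. -/
theorem SimpleGraph.Connected.exists_adj_dist_add_one_eq {V : Type*} {G : SimpleGraph V}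
    (hG : G.Connected) {r v : V} (hv : v ≠ r) :
    ∃ u, G.Adj u v ∧ G.dist r u + 1 = G.dist r v := by
  obtain ⟨w, hw⟩ := hG.exists_walk_length_eq_dist v r
  cases w with
  | nil => exact absurd rfl hv
  | @cons _ u _ huv q =>
    refine ⟨u, huv.symm, ?_⟩
    rw [SimpleGraph.Walk.length_cons, SimpleGraph.dist_comm] at hw
    have h₁ := SimpleGraph.dist_le q
    rw [SimpleGraph.dist_comm] at h₁
    have h₂ := huv.symm.diff_dist_adj (u := r)
    omega

/-- Label the path from `r` to each vertex of a connected graph, along a parent function `p`. -/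
theorem exists_pathLabel {V α : Type*} {r : V} {p : V → V} {d : V → ℕ} (c : V → α)
    (hp : ∀ v ≠ r, d (p v) + 1 = d v) :
    ∃ f : V → List α, (∀ v, (f v).length = d v) ∧ ∀ v ≠ r, f v = f (p v) ++ [c v] := by
  refine ⟨fun v => ((List.iterate p v (d v)).map c).reverse, by simp, fun v hv => ?_⟩
  simp [← hp v hv, List.iterate]

/-- A finite tree of height at most `h` (every vertex at distance at most `h` from the
root `r`) with `m` edges admits an enumeration `e_1, …, e_m` of its edges such that for
all `i ≤ j`, the subgraph consisting of the edges `e_i, …, e_j` and their endpoints has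
at most `h + 1` connected components. -/
theorem tree_path_similarity {V : Type*} [Fintype V]
    (G : SimpleGraph V) (hG : G.IsTree) (r : V) (h m : ℕ)
    (hm : Nat.card G.edgeSet = m)
    (hheight : ∀ v, G.dist r v ≤ h) :
    ∃ e : Fin m → Sym2 V, Function.Injective e ∧ Set.range e = G.edgeSet ∧
      ∀ i j : Fin m, i ≤ j →
        edgeComponents {f | ∃ t : Fin m, i ≤ t ∧ t ≤ j ∧ f = e t} ≤ h + 1 := by
  classical
  choose! p hadj hp using fun v (hv : v ≠ r) => hG.connected.exists_adj_dist_add_one_eq hv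
  obtain ⟨f, hlen, hf⟩ := exists_pathLabel (Fintype.equivFin V) hp
  have hfr : f r = [] := List.length_eq_zero_iff.1 (by rw [hlen, SimpleGraph.dist_self])
  have hf_inj : Function.Injective f := by
    intro u v huv
    by_cases hu : u = r <;> by_cases hv : v = r
    · rw [hu, hv]
    · simp [hu, hfr, hf v hv] at huv
    · simp [hv, hfr, hf u hu] at huv
    · rw [hf u hu, hf v hv] at huv
      simpa using (List.append_inj' huv rfl).2
  have hlt : ∀ v ≠ r, f (p v) < f v := fun v hv => by
    rw [hf v hv]
    simpa using List.append_left_lt (l₁ := f (p v)) (List.nil_lt_cons (Fintype.equivFin V v) [])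
  let _ : LinearOrder V := LinearOrder.lift' f hf_inj
  have lt_iff : ∀ u v : V, u < v ↔ f u < f v := fun _ _ => Iff.rfl
  set N : Finset V := Finset.univ.erase r with hN
  have hcard : N.card = m := by
    have := hG.card_edgeFinset
    rw [← SimpleGraph.card_edgeSet, ← Nat.card_eq_fintype_card, hm] at this
    simp [hN, ← this]
  have parent_inj : ∀ u ≠ r, ∀ v ≠ r, s(p u, u) = s(p v, v) → u = v := by
    intro u hu v hv huv
    obtain ⟨-, h⟩ | ⟨h₁, h₂⟩ := Sym2.eq_iff.1 huv
    · exact h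
    · have h₃ := hp u hu
      have h₄ := hp v hv
      rw [h₁] at h₃
      rw [← h₂] at h₄
      omega
  set o := N.orderEmbOfFin hcard
  have ho : ∀ t, o t ≠ r := fun t => Finset.ne_of_mem_erase (N.orderEmbOfFin_mem hcard t)
  have ho_surj : ∀ v ≠ r, ∃ t, o t = v := fun v hv => by
    have : v ∈ Set.range o := by
      rw [N.range_orderEmbOfFin hcard]
      simpa [hN] using hv
    exact this
  have he_inj : Function.Injective fun t => s(p (o t), o t) := fun t t' h =>
    o.injective (parent_inj _ (ho t) _ (ho t') h)
  refine ⟨fun t => s(p (o t), o t), he_inj, ?_, fun i j _ => ?_⟩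
  · refine Set.eq_of_subset_of_ncard_le ?_ ?_ (Set.toFinite _)
    · rintro _ ⟨t, rfl⟩
      exact hadj _ (ho t)
    · rw [← Set.image_univ, Set.ncard_image_of_injective _ he_inj, Set.ncard_univ,
        Nat.card_eq_fintype_card, Fintype.card_fin, ← Nat.card_coe_set_eq, hm]
  set A : Set V := {w | f w <+: f (o i) ∧ (f w).length < (f (o i)).length}
  calc edgeComponents _ ≤ A.ncard := edgeComponents_le_ncard (Set.toFinite _) (G.dist r) ?_
    _ ≤ (Set.Iio (f (o i)).length).ncard := ?_
    _ ≤ h + 1 := by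
      simpa [Set.ncard_eq_toFinset_card', hlen] using (hheight (o i)).trans (Nat.le_succ h)
  · rintro x ⟨_, ⟨t, hit, htj, rfl⟩, hx⟩
    by_cases hblock : ∃ t', i ≤ t' ∧ t' ≤ j ∧ o t' = x
    · obtain ⟨t', hit', htj', rfl⟩ := hblock
      exact .inr ⟨p (o t'), ⟨t', hit', htj', rfl⟩, by have := hp _ (ho t'); omega⟩
    obtain rfl | rfl := Sym2.mem_iff.1 hx
    swap
    · exact absurd ⟨t, hit, htj, rfl⟩ hblock
    have hxi : p (o t) < o i := by
      by_cases hr : p (o t) = r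
      · rw [lt_iff, hr, hfr, hf _ (ho i)]
        cases f (p (o i)) <;> exact List.nil_lt_cons _ _
      obtain ⟨s, hs⟩ := ho_surj _ hr
      rw [← hs]
      by_contra! his
      have hst : o s < o t := by rw [hs]; exact hlt _ (ho t)
      exact hblock ⟨s, o.le_iff_le.1 his, (o.lt_iff_lt.1 hst).le.trans htj, hs⟩
    have hpre : f (p (o t)) <+: f (o i) :=
      List.isPrefix_of_not_lt_of_not_lt (c := f (o t)) ⟨_, (hf _ (ho t)).symm⟩
        hxi.not_gt (o.monotone hit).not_gt
    refine .inl ⟨hpre, lt_of_le_of_ne hpre.length_le fun hl => ?_⟩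
    exact hxi.ne (hf_inj (hpre.eq_of_length hl))
  · refine Set.ncard_le_ncard_of_injOn (fun w => (f w).length) (fun w hw => hw.2) ?_
      (Set.finite_Iio _)
    intro u hu v hv huv
    exact hf_inj ((List.prefix_of_prefix_length_le hu.1 hv.1 huv.le).eq_of_length huv)
end

section
/- Let G be a finite connected simple graph with m edges, and suppose G has a spanning tree of diameter d (the maximum graph distance, within the tree, between two vertices). Then there exists an enumeration e_1, …, e_m of the edges of G such that for all 1 ≤ i ≤ j ≤ m, the subgraph of G whose edge set is {e_i, e_{i+1}, …, e_j} and whose vertex set is the set of endpoints of these edges has at most ⌈d/2⌉ + 2 connected components. -/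
/-- If `b` lies in the lexicographic interval between `a` and `a ++ t`, then `a` is a prefix
of `b`. -/
theorem List.prefix_of_lt_of_not_append_lt {α : Type*} [LinearOrder α] (t : List α) :
    ∀ a b : List α, a < b → ¬ a ++ t < b → a ++ t ≠ b → a <+: b
  | [], _, _, _, _ => List.nil_prefix
  | _ :: _, [], h, _, _ => absurd h (List.not_lt_nil _)
  | x :: a, y :: b, h, h', h'' => by
    rw [List.cons_lt_cons_iff] at h
    rw [List.cons_append, List.cons_lt_cons_iff, not_or] at h'
    obtain h | ⟨rfl, h⟩ := h
    · exact absurd h h'.1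
    · exact List.cons_prefix_cons.2 ⟨rfl, prefix_of_lt_of_not_append_lt t a b h
        (fun hl ↦ h'.2 ⟨rfl, hl⟩) (fun he ↦ h'' (by rw [List.cons_append, he]))⟩

theorem List.lt_append_singleton {α : Type*} [LinearOrder α] (a : List α) (w : α) :
    a < a ++ [w] := by
  simpa using List.append_left_lt (l₁ := a) (List.nil_lt_cons w [])

namespace SimpleGraph

variable {V : Type*} {T : SimpleGraph V}

/-- In a tree, a vertex has at most one neighbour closer to a given vertex `w`. -/
theorem IsTree.eq_of_adj_of_dist_add_one (hT : T.IsTree) {w a a' b : V} (h : T.Adj a b)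
    (h' : T.Adj a' b) (hd : T.dist w b = T.dist w a + 1) (hd' : T.dist w b = T.dist w a' + 1) :
    a = a' := by
  classical
  obtain ⟨p, hp, -⟩ := (hT.connected w b).exists_path_of_dist
  have key : ∀ x, T.Adj x b → T.dist w b = T.dist w x + 1 → x = p.penultimate := by
    intro x hx hdx
    obtain ⟨q, hq, hql⟩ := (hT.connected w x).exists_path_of_dist
    refine hT.isAcyclic.eq_penultimate_of_adj_end hp hx.symm ?_
    refine hT.isAcyclic.mem_support_of_ne_mem_support_of_adj_of_isPath hp hq hx.symm fun hb ↦ ?_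
    have h₁ := dist_le (q.takeUntil b hb)
    have h₂ := q.length_takeUntil_le_length hb
    omega
  rw [key a h hd, key a' h' hd']

/-- Along a path in a tree, the distance to a fixed vertex keeps increasing once it increases. -/
theorem IsTree.dist_getVert_of_increasing (hT : T.IsTree) {u v : V} {p : T.Walk u v}
    (hp : p.IsPath) (w : V) {k : ℕ}
    (h : T.dist w (p.getVert (k + 1)) = T.dist w (p.getVert k) + 1) (n : ℕ)
    (hn : k + n < p.length) :
    T.dist w (p.getVert (k + n + 1)) = T.dist w (p.getVert (k + n)) + 1 ∧
      T.dist w (p.getVert (k + n)) = T.dist w (p.getVert k) + n := by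
  induction n with
  | zero => simpa using h
  | succ n ih =>
    obtain ⟨ih₁, ih₂⟩ := ih (by omega)
    have hadj := p.adj_getVert_succ (i := k + n) (by omega)
    have hadj' := p.adj_getVert_succ (i := k + n + 1) (by omega)
    rw [← add_assoc]
    refine ⟨?_, by omega⟩
    rcases hT.dist_eq_dist_add_one_of_adj w hadj' with h₁ | h₁
    · have := hT.eq_of_adj_of_dist_add_one hadj hadj'.symm ih₁ h₁
      have := hp.getVert_injOn (by simp; omega) (by simp; omega) this
      omega
    · exact h₁

/-- A tree of diameter `d` has a vertex at distance at most `⌈d / 2⌉` from every vertex. -/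
theorem IsTree.exists_forall_dist_le (hT : T.IsTree) {d : ℕ} (hub : ∀ u v : V, T.dist u v ≤ d)
    (hex : ∃ u v : V, T.dist u v = d) : ∃ c, ∀ w, T.dist w c ≤ (d + 1) / 2 := by
  obtain ⟨u, v, huv⟩ := hex
  obtain ⟨p, hp, hpl⟩ := (hT.connected u v).exists_path_of_dist
  refine ⟨p.getVert (d / 2), fun w ↦ ?_⟩
  obtain rfl | hd := Nat.eq_zero_or_pos d
  · exact hub _ _
  rcases hT.dist_eq_dist_add_one_of_adj w (p.adj_getVert_succ (i := d / 2) (by omega)) with h | h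
  · have hk : d - d / 2 - 1 + 1 = d - d / 2 := by omega
    have h₁ : p.reverse.getVert (d - d / 2) = p.getVert (d / 2) := by
      rw [Walk.getVert_reverse]; congr 1; omega
    have h₂ : p.reverse.getVert (d - d / 2 - 1) = p.getVert (d / 2 + 1) := by
      rw [Walk.getVert_reverse]; congr 1; omega
    have := hT.dist_getVert_of_increasing hp.reverse w (k := d - d / 2 - 1)
      (by rw [hk, h₁, h₂, h]) (d / 2) (by rw [Walk.length_reverse]; omega)
    have := hub w (p.reverse.getVert (d - d / 2 - 1 + d / 2 + 1))
    rw [h₂] at *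
    omega
  · have := hT.dist_getVert_of_increasing hp w h (d - d / 2 - 1) (by omega)
    have := hub w (p.getVert (d / 2 + (d - d / 2 - 1) + 1))
    omega

/-- Assigning to each vertex the list of vertices on the tree path from `c`. -/
theorem IsTree.exists_rootPath (hT : T.IsTree) (c : V) :
    ∃ P : V → List V, P c = [c] ∧ (∀ v, (P v).length = T.dist c v + 1) ∧
      (∀ v, ∃ t, P v = c :: t) ∧ (∀ v, ∃ t, P v = t ++ [v]) ∧
      (∀ v, v ≠ c → ∃ u, T.Adj u v ∧ P v = P u ++ [v]) ∧
      ∀ a b, T.Adj a b → P b = P a ++ [b] ∨ P a = P b ++ [a] := by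
  choose p hp hpl using fun v ↦ (hT.connected c v).exists_path_of_dist
  have hadj : ∀ a b, T.Adj a b → (p b).support = (p a).support ++ [b] ∨
      (p a).support = (p b).support ++ [a] := by
    intro a b hab
    by_cases h : a ∈ (p b).support
    · left
      rw [hT.isAcyclic.path_concat (hp a) (hp b) hab h, Walk.support_concat]
    · right
      rw [hT.isAcyclic.path_concat (hp b) (hp a) hab.symm
        (hT.isAcyclic.mem_support_of_ne_mem_support_of_adj_of_isPath (hp a) (hp b) hab h),
        Walk.support_concat]
  refine ⟨fun v ↦ (p v).support, ?_, fun v ↦ by simp [hpl], fun v ↦ ⟨_, (p v).cons_tail_support.symm⟩,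
    fun v ↦ ⟨_, (p v).dropLast_support_concat.symm⟩, fun v hv ↦ ?_, hadj⟩
  · have := Walk.nil_iff_support_eq.1 (Walk.isPath_iff_nil.1 (hp c))
    exact this
  · have hnil : ¬ (p v).Nil := fun h ↦ hv h.eq.symm
    refine ⟨(p v).penultimate, (p v).adj_penultimate hnil, ?_⟩
    have h := (p v).adj_penultimate hnil
    dsimp only
    rw [← Walk.support_concat _ h, ← hT.isAcyclic.path_concat (hp _) (hp v) h]
    exact (p v).getVert_mem_support _

/-- The depth-first keys of the edges of `G`: after attaching each non-tree edge to the tree `T` as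
a pendant edge, the key of an edge is the list of vertices on the path from `c` through it. -/
theorem IsTree.exists_edgeKey (hT : T.IsTree) {G : SimpleGraph V} (hTG : T ≤ G) {c : V} {h : ℕ}
    (hc : ∀ v, T.dist c v ≤ h) :
    ∃ L : Sym2 V → List V, ∀ e ∈ G.edgeSet, (L e).length ≤ h + 2 ∧ (∃ t, L e = c :: t) ∧
      ∃ q u w, e = s(u, w) ∧ L e = q ++ [u] ++ [w] ∧
        (q ++ [u] = [c] ∨ ∃ f ∈ G.edgeSet, L f = q ++ [u]) := by
  obtain ⟨P, hPc, hlen, hcons, hconcat, hpar, hadj⟩ := hT.exists_rootPath c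
  have hex : ∀ e : Sym2 V, ∃ u w, e = s(u, w) ∧ (e ∈ T.edgeSet → P w = P u ++ [w]) := by
    intro e
    induction e with
    | _ a b =>
      by_cases hab : T.Adj a b
      · rcases hadj a b hab with h | h
        · exact ⟨a, b, rfl, fun _ ↦ h⟩
        · exact ⟨b, a, Sym2.eq_swap, fun _ ↦ h⟩
      · exact ⟨a, b, rfl, fun h ↦ absurd h hab⟩
  choose top bot he hP using hex
  refine ⟨fun e ↦ P (top e) ++ [bot e], fun e _ ↦ ⟨?_, ?_, ?_⟩⟩
  · simp [hlen, hc]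
  · obtain ⟨t, ht⟩ := hcons (top e)
    exact ⟨t ++ [bot e], by simp [ht]⟩
  · obtain ⟨q, hq⟩ := hconcat (top e)
    refine ⟨q, top e, bot e, he e, by simp only [hq], ?_⟩
    rw [← hq]
    by_cases htop : top e = c
    · exact .inl (htop ▸ hPc)
    obtain ⟨u, hu, hPu⟩ := hpar _ htop
    have hf : s(u, top e) ∈ T.edgeSet := hu
    refine .inr ⟨s(u, top e), hTG hu, ?_⟩
    have hPf := hP _ hf
    dsimp only
    rw [← hPf]
    rcases Sym2.eq_iff.1 (he s(u, top e)) with ⟨-, h₂⟩ | ⟨h₁, h₂⟩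
    · rw [← h₂]
    · rw [← h₁, ← h₂, hPu] at hPf
      simpa using congrArg List.length hPf

end SimpleGraph

open SimpleGraph in
/-- The number of components of an edge set `S` is at most `n` if each endpoint of `S` is joined,
within `S`, to one of `n` vertices. -/
theorem edgeComponents_le {V : Type*} {S : Set (Sym2 V)} {n : ℕ} (g : Fin n → V)
    (h : ∀ x : {v | ∃ e ∈ S, v ∈ e}, ∃ (k : Fin n) (y : {v | ∃ e ∈ S, v ∈ e}), g k = y ∧
      ((fromEdgeSet S).induce {v | ∃ e ∈ S, v ∈ e}).Reachable x y) :
    edgeComponents S ≤ n := by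
  choose k y hg hr using h
  rw [edgeComponents, ← Nat.card_fin n]
  refine Nat.card_le_card_of_injective (fun C ↦ k C.out) fun C D hCD ↦ ?_
  have hy : y C.out = y D.out := Subtype.ext (by rw [← hg, ← hg]; exact congrArg g hCD)
  rw [← C.out_eq, ← D.out_eq]
  exact ConnectedComponent.sound ((hr _).trans (hy ▸ (hr _).symm))

open SimpleGraph in
/-- An interval of edges in the depth-first order has few components: each of them contains
a vertex of the key of the first edge, other than the last vertex of that key. -/
theorem edgeComponents_le_of_edgeKey {V : Type*} [LinearOrder V] {E S : Set (Sym2 V)}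
    {L : Sym2 V → List V} {c : V} (hE : ∀ e ∈ E, (∃ t, L e = c :: t) ∧
      ∃ q u w, e = s(u, w) ∧ L e = q ++ [u] ++ [w] ∧
        (q ++ [u] = [c] ∨ ∃ f ∈ E, L f = q ++ [u]))
    (hSE : S ⊆ E) {a : Sym2 V} (ha : a ∈ S)
    (hmin : ∀ e ∈ S, ¬ L e < L a)
    (hint : ∀ f ∈ E, ∀ e ∈ S, ¬ L f < L a → L f < L e → f ∈ S) :
    edgeComponents S ≤ (L a).length - 1 := by
  set W : Set V := {v | ∃ e ∈ S, v ∈ e}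
  set H := (fromEdgeSet S).induce W
  have hlast : ∀ e ∈ E, ∀ l x, L e = l ++ [x] → x ∈ e := by
    intro e he l x hl
    obtain ⟨-, q, u, w, rfl, hq, -⟩ := hE e he
    rw [hq] at hl
    have := (List.append_inj' hl rfl).2
    simp_all
  have hmem : ∀ e ∈ S, ∀ x ∈ e, x ∈ W := fun e he x hx ↦ ⟨e, he, hx⟩
  have hedge : ∀ e ∈ S, ∀ x y (hx : x ∈ W) (hy : y ∈ W), x ∈ e → y ∈ e →
      H.Reachable ⟨x, hx⟩ ⟨y, hy⟩ := by
    intro e he x y hx hy hxe hye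
    by_cases hxy : x = y
    · subst hxy; rfl
    · have : e = s(x, y) := (Sym2.mem_and_mem_iff hxy).1 ⟨hxe, hye⟩
      refine Adj.reachable ?_
      simp only [H, comap_adj, fromEdgeSet_adj, Function.Embedding.subtype_apply]
      exact ⟨this ▸ he, hxy⟩
  have key : ∀ n, ∀ e ∈ S, (L e).length = n → ∀ x (hx : x ∈ W), x ∈ e →
      ∃ (k : Fin ((L a).length - 1)) (y : W), (L a)[k]'(by omega) = y ∧
        H.Reachable ⟨x, hx⟩ y := by
    intro n
    induction n with
    | zero =>
      intro e he h0
      obtain ⟨⟨t, ht⟩, -⟩ := hE e (hSE he)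
      simp [ht] at h0
    | succ n ih =>
      intro e he hn x hx hxe
      obtain ⟨-, q, u, w, heq, hq, hf⟩ := hE e (hSE he)
      have hue : u ∈ e := heq ▸ Sym2.mem_mk_left u w
      have hxu := hedge e he x u hx (hmem e he u hue) hxe hue
      by_cases hpre : q ++ [u] <+: L a ∧ q ++ [u] ≠ L a
      · obtain ⟨⟨t, ht⟩, hne⟩ := hpre
        have hlen := congrArg List.length ht
        have ht0 : t.length ≠ 0 := fun h0 ↦ hne (by simpa [List.length_eq_zero_iff.1 h0] using ht)
        simp only [List.length_append, List.length_singleton] at hlen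
        refine ⟨⟨q.length, by omega⟩, ⟨u, hmem e he u hue⟩, ?_, hxu⟩
        simp [← ht]
      · obtain ⟨f, hfE, hf⟩ : ∃ f ∈ E, L f = q ++ [u] := by
          refine hf.resolve_left fun hqc ↦ hpre ?_
          obtain ⟨⟨t, ht⟩, q', u', w', -, hq', -⟩ := hE a (hSE ha)
          refine ⟨hqc ▸ ht ▸ ⟨t, rfl⟩, fun heq ↦ ?_⟩
          rw [← heq, hqc] at hq'
          simpa using congrArg List.length hq'
        have hfe : L f < L e := by rw [hq, hf]; exact List.lt_append_singleton _ _
        have hfa : ¬ L f < L a := by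
          intro hlt
          refine hpre ⟨?_, hf ▸ hlt.ne⟩
          by_cases hea : L e = L a
          · rw [← hea, hq]; exact List.prefix_append _ _
          · exact List.prefix_of_lt_of_not_append_lt [w] _ _ (hf ▸ hlt) (hq ▸ hmin e he) (hq ▸ hea)
        have hfS := hint f hfE e he hfa hfe
        have huf := hlast f hfE q u hf
        obtain ⟨k, y, hk, hr⟩ := ih f hfS (by rw [hq] at hn; rw [hf]; simpa using hn) u
          (hmem e he u hue) huf
        exact ⟨k, y, hk, hxu.trans hr⟩
  refine edgeComponents_le (fun k ↦ (L a)[k]'(by omega)) fun ⟨x, hx⟩ ↦ ?_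
  obtain ⟨e, he, hxe⟩ := id hx
  exact key _ e he rfl x hx hxe

/-- A finite connected graph with `m` edges admitting a spanning tree of diameter `d`
has an enumeration `e_1, …, e_m` of its edges such that for all `i ≤ j`, the subgraph
consisting of the edges `e_i, …, e_j` and their endpoints has at most `⌈d/2⌉ + 2`
connected components (`⌈d/2⌉` is written `(d + 1) / 2` with natural-number division). -/
theorem graph_path_similarity {V : Type*} [Fintype V]
    (G : SimpleGraph V) (hconn : G.Connected) (m d : ℕ)
    (hm : Nat.card G.edgeSet = m)
    (T : SimpleGraph V) (hTG : T ≤ G) (hT : T.IsTree)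
    (hub : ∀ u v : V, T.dist u v ≤ d)
    (hex : ∃ u v : V, T.dist u v = d) :
    ∃ e : Fin m → Sym2 V, Function.Injective e ∧ Set.range e = G.edgeSet ∧
      ∀ i j : Fin m, i ≤ j →
        edgeComponents {f | ∃ t : Fin m, i ≤ t ∧ t ≤ j ∧ f = e t} ≤ (d + 1) / 2 + 2 := by
  classical
  let : LinearOrder V := LinearOrder.lift' _ (Fintype.equivFin V).injective
  obtain ⟨c, hc⟩ := hT.exists_forall_dist_le hub hex
  obtain ⟨L, hL⟩ := hT.exists_edgeKey hTG (c := c) fun v ↦ T.dist_comm.trans_le (hc v)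
  have hinj : Set.InjOn L G.edgeSet := by
    intro e he f hf hef
    obtain ⟨-, -, q, u, w, rfl, hq, -⟩ := hL e he
    obtain ⟨-, -, q', u', w', rfl, hq', -⟩ := hL f hf
    rw [hq, hq'] at hef
    obtain ⟨h₁, h₂⟩ := List.append_inj' hef rfl
    obtain ⟨-, h₃⟩ := List.append_inj' h₁ rfl
    simp_all
  let K : Finset (List V) := G.edgeFinset.image L
  have hK : K.card = m := by
    rw [Finset.card_image_of_injOn (by simpa using hinj), ← hm, Nat.card_eq_fintype_card,
      SimpleGraph.edgeFinset_card]
  let o := K.orderEmbOfFin hK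
  have ho : ∀ t, ∃ e ∈ G.edgeSet, L e = o t := fun t ↦ by
    obtain ⟨e, he, heo⟩ := Finset.mem_image.1 (K.orderEmbOfFin_mem hK t)
    exact ⟨e, by simpa using he, heo⟩
  choose e heG heL using ho
  have hsurj : ∀ f ∈ G.edgeSet, ∃ t, e t = f := by
    intro f hf
    have hfK : L f ∈ Set.range o := by
      rw [Finset.range_orderEmbOfFin]
      exact Finset.mem_image_of_mem L (by simpa using hf)
    obtain ⟨t, ht⟩ := hfK
    exact ⟨t, hinj (heG t) hf ((heL t).trans ht)⟩
  refine ⟨e, fun s t hst ↦ o.injective (by rw [← heL, ← heL, hst]),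
    Set.Subset.antisymm (Set.range_subset_iff.2 heG) hsurj, fun i j hij ↦ ?_⟩
  have hlt : ∀ s t, L (e s) < L (e t) ↔ s < t := fun s t ↦ by rw [heL, heL, o.lt_iff_lt]
  refine le_trans (edgeComponents_le_of_edgeKey (L := L) (c := c) (a := e i)
    (fun f hf ↦ (hL f hf).2) ?_ ⟨i, le_rfl, hij, rfl⟩ ?_ ?_) ?_
  · rintro _ ⟨t, -, -, rfl⟩
    exact heG t
  · rintro _ ⟨t, hit, -, rfl⟩
    rw [hlt]
    exact hit.not_gt
  · rintro f hf _ ⟨t, -, htj, rfl⟩ hfi hft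
    obtain ⟨s, rfl⟩ := hsurj f hf
    rw [hlt] at hfi hft
    exact ⟨s, not_lt.1 hfi, hft.le.trans htj, rfl⟩
  · have := (hL _ (heG i)).1
    omega
end
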